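/- The number of partitions of n into triangular numbers satisfies p₃(n) ~ (ζ(3/2) / (2^{7/2} √3 π n^{3/2})) · exp( (3/2) π^{1/3} ζ(3/2)^{2/3} n^{1/3} ) as n → ∞. -/

import Mathlib

open Filter Topology

/-- `ζ(3/2)` as a real series. -/
noncomputable def zetaThreeHalves : ℝ := ∑' m : ℕ, ((m + 1 : ℝ)) ^ (-(3 / 2 : ℝ))

/-- The number of partitions of `n` into triangular numbers. -/
noncomputable def pTri (n : ℕ) : ℕ :=
  Nat.card {q : Nat.Partition n // ∀ i ∈ q.parts, ∃ m : ℕ, 1 ≤ m ∧ 2 * i = m * (m + 1)}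


namespace TriPart

/-- shifted triangular numbers -/
def tri (m : ℕ) : ℕ := (m + 1) * (m + 2) / 2

lemma two_mul_tri (m : ℕ) : 2 * tri m = (m + 1) * (m + 2) :=
  Nat.mul_div_cancel' (Nat.even_mul_succ_self (m + 1)).two_dvd

lemma le_tri (m : ℕ) : m + 1 ≤ tri m := by
  have := two_mul_tri m
  nlinarith

lemma tri_strictMono : StrictMono tri := by
  apply strictMono_nat_of_lt_succ
  intro m
  have := two_mul_tri m
  have := two_mul_tri (m + 1)
  nlinarith

open PowerSeries in
lemma coeff_mul_hasSum (x : ℂ) (φ ψ : PowerSeries ℂ) (a b : ℂ)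
    (h1 : Summable fun n => ‖coeff n φ * x ^ n‖) (h1' : HasSum (fun n => coeff n φ * x ^ n) a)
    (h2 : Summable fun n => ‖coeff n ψ * x ^ n‖) (h2' : HasSum (fun n => coeff n ψ * x ^ n) b) :
    (Summable fun n => ‖coeff n (φ * ψ) * x ^ n‖) ∧
      HasSum (fun n => coeff n (φ * ψ) * x ^ n) (a * b) := by
  have key : ∀ n, coeff n (φ * ψ) * x ^ n = ∑ p ∈ Finset.HasAntidiagonal.antidiagonal n,
      (coeff p.1 φ * x ^ p.1) * (coeff p.2 ψ * x ^ p.2) := by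
    intro n
    rw [coeff_mul, Finset.sum_mul]
    apply Finset.sum_congr rfl
    intro p hp
    rw [Finset.HasAntidiagonal.mem_antidiagonal] at hp
    rw [← hp, pow_add]; ring
  have e1 : (fun n => coeff n (φ * ψ) * x ^ n) = fun n => ∑ p ∈ Finset.HasAntidiagonal.antidiagonal n,
      (coeff p.1 φ * x ^ p.1) * (coeff p.2 ψ * x ^ p.2) := funext key
  have hs : Summable fun n => ‖∑ p ∈ Finset.HasAntidiagonal.antidiagonal n,
      (coeff p.1 φ * x ^ p.1) * (coeff p.2 ψ * x ^ p.2)‖ :=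
    summable_norm_sum_mul_antidiagonal_of_summable_norm
      (f := fun n => coeff n φ * x ^ n) (g := fun n => coeff n ψ * x ^ n) h1 h2
  have ht := tsum_mul_tsum_eq_tsum_sum_antidiagonal_of_summable_norm
      (f := fun n => coeff n φ * x ^ n) (g := fun n => coeff n ψ * x ^ n) h1 h2
  rw [h1'.tsum_eq, h2'.tsum_eq] at ht
  constructor
  · simpa only [key] using hs
  · rw [e1, ht]
    exact hs.of_norm.hasSum

/-- geometric power series -/
noncomputable def geo (k : ℕ) : PowerSeries ℂ := PowerSeries.mk fun n => if k ∣ n then 1 else 0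

open scoped PowerSeries.WithPiTopology in
lemma tsum_X_pow (k : ℕ) (hk : 0 < k) :
    (∑' j : ℕ, (PowerSeries.X ^ (k * j) : PowerSeries ℂ)) = geo k := by
  apply HasSum.tsum_eq
  rw [HasSum, PowerSeries.WithPiTopology.tendsto_iff_coeff_tendsto]
  intro d
  simp only [map_sum, PowerSeries.coeff_X_pow, geo, PowerSeries.coeff_mk]
  change HasSum (fun j => if d = k * j then (1:ℂ) else 0) _
  by_cases h : k ∣ d
  · obtain ⟨j, rfl⟩ := h
    simp only [dvd_mul_right, if_true]
    convert hasSum_ite_eq j (1:ℂ) using 2 with i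
    simp [hk.ne', eq_comm]
  · simp only [h, if_false]
    convert hasSum_zero (α := ℂ) (β := ℕ) using 2 with i
    rw [if_neg]
    rintro rfl
    exact h (dvd_mul_right _ _)

lemma geo_hasSum (x : ℂ) (hx : ‖x‖ < 1) (k : ℕ) (hk : 0 < k) :
    (Summable fun n => ‖PowerSeries.coeff n (geo k) * x ^ n‖) ∧
      HasSum (fun n => PowerSeries.coeff n (geo k) * x ^ n) (1 - x ^ k)⁻¹ := by
  have hxk : ‖x ^ k‖ < 1 := by
    rw [norm_pow]; exact pow_lt_one₀ (norm_nonneg _) hx hk.ne'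
  constructor
  · apply Summable.of_nonneg_of_le (fun _ => norm_nonneg _) _ (summable_geometric_of_lt_one (norm_nonneg x) hx)
    intro n
    rw [norm_mul, norm_pow, geo, PowerSeries.coeff_mk]
    have : (0:ℝ) ≤ ‖x‖ ^ n := by positivity
    split_ifs
    · simp
    · simpa using this
  · have hinj : Function.Injective (fun j : ℕ => k * j) := fun a b h => Nat.eq_of_mul_eq_mul_left hk h
    rw [← hinj.hasSum_iff]
    · have e : (fun n => PowerSeries.coeff n (geo k) * x ^ n) ∘ (fun j : ℕ => k * j) = fun j => (x ^ k) ^ j := by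
        funext j
        simp [geo, pow_mul]
      rw [e]
      exact hasSum_geometric_of_norm_lt_one hxk
    · intro n hn
      have : ¬ k ∣ n := by
        rintro ⟨j, rfl⟩
        exact hn ⟨j, rfl⟩
      simp [geo, this]

lemma prod_geo_hasSum (x : ℂ) (hx : ‖x‖ < 1) (S : Finset ℕ) (hS : ∀ k ∈ S, 0 < k) :
    (Summable fun n => ‖PowerSeries.coeff n (∏ k ∈ S, geo k) * x ^ n‖) ∧
      HasSum (fun n => PowerSeries.coeff n (∏ k ∈ S, geo k) * x ^ n) (∏ k ∈ S, (1 - x ^ k)⁻¹) := by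
  induction S using Finset.induction_on with
  | empty =>
    simp only [Finset.prod_empty, PowerSeries.coeff_one]
    have h : ∀ n : ℕ, n ≠ 0 → (if n = 0 then (1:ℂ) else 0) * x ^ n = 0 := by
      intro n hn; simp [hn]
    constructor
    · apply summable_of_ne_finset_zero (s := {0})
      intro n hn
      rw [h n (by simpa using hn), norm_zero]
    · convert hasSum_single 0 h using 1
      simp
  | insert k S hk ih =>
    rw [Finset.prod_insert hk, Finset.prod_insert hk]
    have h1 := geo_hasSum x hx k (hS k (Finset.mem_insert_self _ _))
    have h2 := ih (fun j hj => hS j (Finset.mem_insert_of_mem hj))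
    exact coeff_mul_hasSum x _ _ _ _ h1.1 h1.2 h2.1 h2.2

open scoped PowerSeries.WithPiTopology in
lemma restricted_eq (S : Finset ℕ) (hS : ∀ k ∈ S, 0 < k) :
    (PowerSeries.mk fun n ↦ ((Nat.Partition.restricted n (· ∈ S)).card : ℂ)) = ∏ k ∈ S, geo k := by
  have h := Nat.Partition.hasProd_powerSeriesMk_card_restricted ℂ (· ∈ S)
  have h2 : HasProd (fun i : ℕ ↦ if i + 1 ∈ S then ∑' j : ℕ, (PowerSeries.X ^ ((i + 1) * j) : PowerSeries ℂ) else 1)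
      (∏ k ∈ S.image (fun k => k - 1), if k + 1 ∈ S then ∑' j : ℕ, (PowerSeries.X ^ ((k + 1) * j) : PowerSeries ℂ) else 1) := by
    apply hasProd_prod_of_ne_finset_one
    intro i hi
    rw [if_neg]
    intro h
    apply hi
    rw [Finset.mem_image]
    exact ⟨i + 1, h, rfl⟩
  rw [h.unique h2, Finset.prod_image]
  · apply Finset.prod_congr rfl
    intro k hk
    have := hS k hk
    rw [Nat.sub_add_cancel this, if_pos hk, tsum_X_pow k this]
  · intro a ha b hb hab
    have := hS a ha
    have := hS b hb
    simp only at hab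
    omega

open Classical in
lemma pTri_eq (n : ℕ) : pTri n =
    ((Finset.univ : Finset (Nat.Partition n)).filter fun q => ∀ i ∈ q.parts, ∃ m : ℕ, i = tri m).card := by
  unfold pTri
  rw [Nat.card_eq_fintype_card, Fintype.card_subtype]
  congr 1
  ext q
  simp only [Finset.mem_filter, Finset.mem_univ, true_and]
  apply forall₂_congr
  intro i hi
  constructor
  · rintro ⟨m, h1, h2⟩
    obtain ⟨k, rfl⟩ : ∃ k, m = k + 1 := ⟨m - 1, by omega⟩
    refine ⟨k, ?_⟩
    have := two_mul_tri k
    linarith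
  · rintro ⟨m, rfl⟩
    exact ⟨m + 1, by omega, by rw [two_mul_tri]⟩

lemma restr_le (M n : ℕ) :
    (Nat.Partition.restricted n (· ∈ (Finset.range M).image tri)).card ≤ pTri n := by
  rw [pTri_eq]
  apply Finset.card_le_card
  intro q
  simp only [Nat.Partition.restricted, Finset.mem_filter, Finset.mem_univ, true_and, Finset.mem_image]
  intro h i hi
  obtain ⟨m, -, rfl⟩ := h i hi
  exact ⟨m, rfl⟩

lemma restr_eq (M n : ℕ) (h : n ≤ M) :
    (Nat.Partition.restricted n (· ∈ (Finset.range M).image tri)).card = pTri n := by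
  apply le_antisymm (restr_le M n)
  rw [pTri_eq]
  apply Finset.card_le_card
  intro q
  simp only [Nat.Partition.restricted, Finset.mem_filter, Finset.mem_univ, true_and, Finset.mem_image]
  intro h i hi
  obtain ⟨m, rfl⟩ := h i hi
  refine ⟨m, ?_, rfl⟩
  have h1 := le_tri m
  have h2 : tri m ≤ n := by
    have := Multiset.le_sum_of_mem hi
    rwa [q.parts_sum] at this
  rw [Finset.mem_range]
  omega

lemma restr_hasSum (x : ℂ) (hx : ‖x‖ < 1) (M : ℕ) :
    HasSum (fun n => ((Nat.Partition.restricted n (· ∈ (Finset.range M).image tri)).card : ℂ) * x ^ n)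
      (∏ m ∈ Finset.range M, (1 - x ^ tri m)⁻¹) := by
  have hS : ∀ k ∈ (Finset.range M).image tri, 0 < k := by
    intro k hk
    rw [Finset.mem_image] at hk
    obtain ⟨m, -, rfl⟩ := hk
    have := le_tri m
    omega
  have h := (prod_geo_hasSum x hx _ hS).2
  rw [← restricted_eq _ hS, Finset.prod_image (fun a _ b _ h => tri_strictMono.injective h)] at h
  simpa only [PowerSeries.coeff_mk] using h

theorem genfun (x : ℂ) (hx : ‖x‖ < 1) (B : ℝ)
    (hB : ∀ M : ℕ, ∏ m ∈ Finset.range M, (1 - ‖x‖ ^ tri m)⁻¹ ≤ B) (L : ℂ)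
    (hL : Tendsto (fun M => ∏ m ∈ Finset.range M, (1 - x ^ tri m)⁻¹) atTop (𝓝 L)) :
    (Summable fun n => (pTri n : ℝ) * ‖x‖ ^ n) ∧ HasSum (fun n => (pTri n : ℂ) * x ^ n) L := by
  have hsum : Summable fun n => (pTri n : ℝ) * ‖x‖ ^ n := by
    apply summable_of_sum_range_le (c := B)
    · intro n; positivity
    · intro N
      refine le_trans ?_ (hB N)
      have hx' : ‖((‖x‖ : ℝ) : ℂ)‖ < 1 := by simpa using hx
      have h1 := restr_hasSum _ hx' N
      have h2 : HasSum (fun n => ((Nat.Partition.restricted n (· ∈ (Finset.range N).image tri)).card : ℝ) * ‖x‖ ^ n)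
        (∏ m ∈ Finset.range N, (1 - ‖x‖ ^ tri m)⁻¹) := by
        rw [← Complex.hasSum_ofReal]
        push_cast
        exact h1
      calc _ = ∑ n ∈ Finset.range N, ((Nat.Partition.restricted n (· ∈ (Finset.range N).image tri)).card : ℝ) * ‖x‖ ^ n := by
            apply Finset.sum_congr rfl
            intro n hn
            rw [restr_eq N n (Finset.mem_range.1 hn).le]
        _ ≤ _ := sum_le_hasSum _ (fun n _ => by positivity) h2
  refine ⟨hsum, ?_⟩
  have hs2 : Summable (fun n => (pTri n : ℂ) * x ^ n) := by
    apply Summable.of_norm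
    simpa using hsum
  have key : Tendsto (fun M => ∑' n, ((Nat.Partition.restricted n (· ∈ (Finset.range M).image tri)).card : ℂ) * x ^ n)
      atTop (𝓝 (∑' n, (pTri n : ℂ) * x ^ n)) := by
    apply tendsto_tsum_of_dominated_convergence hsum
    · intro n
      apply tendsto_const_nhds.congr'
      filter_upwards [eventually_ge_atTop n] with M hM
      rw [restr_eq M n hM]
    · filter_upwards with M n
      rw [norm_mul, norm_pow, Complex.norm_natCast]
      gcongr
      exact restr_le M n
  have : (fun M => ∑' n, ((Nat.Partition.restricted n (· ∈ (Finset.range M).image tri)).card : ℂ) * x ^ n)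
      = (fun M => ∏ m ∈ Finset.range M, (1 - x ^ tri m)⁻¹) := by
    funext M
    exact (restr_hasSum x hx M).tsum_eq
  rw [this] at key
  rw [tendsto_nhds_unique hL key]
  exact hs2.hasSum

end TriPart


namespace TriPart

/-- `-log (1 - e^{-x})` -/
noncomputable def fL (x : ℂ) : ℂ := -Complex.log (1 - Complex.exp (-x))

/-- first derivative of `fL` -/
noncomputable def d1 (x : ℂ) : ℂ := -(Complex.exp (-x) / (1 - Complex.exp (-x)))

/-- second derivative of `fL` -/
noncomputable def d2 (x : ℂ) : ℂ := Complex.exp (-x) / (1 - Complex.exp (-x)) ^ 2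

/-- the cone -/
def cone : Set ℂ := {z | 0 < z.re ∧ |z.im| ≤ z.re}

lemma norm_exp_neg_lt {x : ℂ} (hx : 0 < x.re) : ‖Complex.exp (-x)‖ < 1 := by
  rw [Complex.norm_exp, Complex.neg_re]
  exact Real.exp_lt_one_iff.2 (by linarith)

lemma re_one_sub_pos {x : ℂ} (hx : 0 < x.re) : 0 < (1 - Complex.exp (-x)).re := by
  have h := norm_exp_neg_lt hx
  have := Complex.re_le_norm (Complex.exp (-x))
  rw [Complex.sub_re, Complex.one_re]
  linarith

lemma one_sub_ne {x : ℂ} (hx : 0 < x.re) : 1 - Complex.exp (-x) ≠ 0 := by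
  intro h
  have := re_one_sub_pos hx
  rw [h] at this
  simp at this

lemma exp_fL {x : ℂ} (hx : 0 < x.re) : Complex.exp (fL x) = (1 - Complex.exp (-x))⁻¹ := by
  rw [fL, Complex.exp_neg, Complex.exp_log (one_sub_ne hx)]

lemma hasDerivAt_fL {x : ℂ} (hx : 0 < x.re) : HasDerivAt fL (d1 x) x := by
  have h1 : HasDerivAt (fun x : ℂ => 1 - Complex.exp (-x)) (Complex.exp (-x)) x := by
    have := ((hasDerivAt_neg x).cexp).const_sub 1
    simpa using this
  have h2 := (h1.clog (Or.inl (re_one_sub_pos hx))).neg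
  exact h2

lemma hasDerivAt_d1 {x : ℂ} (hx : 0 < x.re) : HasDerivAt d1 (d2 x) x := by
  have h0 : HasDerivAt (fun x : ℂ => Complex.exp (-x)) (-Complex.exp (-x)) x := by
    have := ((hasDerivAt_neg x).cexp)
    simpa using this
  have h1 : HasDerivAt (fun x : ℂ => 1 - Complex.exp (-x)) (Complex.exp (-x)) x := by
    have := h0.const_sub 1
    simpa using this
  have h2 := (h0.div h1 (one_sub_ne hx)).neg
  have hne := one_sub_ne hx
  refine HasDerivAt.congr_deriv h2 ?_
  rw [d2]
  field_simp
  ring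

lemma norm_one_sub_ge (x : ℂ) : 1 - Real.exp (-x.re) ≤ ‖1 - Complex.exp (-x)‖ := by
  have := norm_sub_norm_le (1:ℂ) (Complex.exp (-x))
  rwa [norm_one, Complex.norm_exp, Complex.neg_re] at this

lemma norm_le_of_cone {x : ℂ} (hx : x ∈ cone) : ‖x‖ ≤ 2 * x.re := by
  have := Complex.norm_le_abs_re_add_abs_im x
  rw [abs_of_pos hx.1] at this
  linarith [hx.2]

lemma bound_d1 {x : ℂ} (hx : x ∈ cone) : ‖x * d1 x‖ ≤ 2 := by
  have ha := hx.1
  set a := x.re with hadef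
  have hE : a * Real.exp (-a) ≤ 1 - Real.exp (-a) := by
    have h1 := Real.add_one_le_exp a
    have h2 : Real.exp a * Real.exp (-a) = 1 := by rw [← Real.exp_add]; simp
    nlinarith [Real.exp_pos (-a)]
  have hpos : 0 < 1 - Real.exp (-a) := by
    have := Real.exp_lt_one_iff.2 (show -a < 0 by linarith)
    linarith
  have h3 := norm_one_sub_ge x
  rw [d1, norm_mul, norm_neg, norm_div, Complex.norm_exp, Complex.neg_re, ← hadef, ← mul_div_assoc,
    div_le_iff₀ (lt_of_lt_of_le hpos h3)]
  have h4 := norm_le_of_cone hx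
  rw [← hadef] at h3 h4
  calc ‖x‖ * Real.exp (-a) ≤ 2 * a * Real.exp (-a) := by gcongr
    _ ≤ 2 * (1 - Real.exp (-a)) := by linarith
    _ ≤ _ := by linarith

lemma bound_d2 {x : ℂ} (hx : x ∈ cone) : ‖x ^ 2 * d2 x‖ ≤ 4 := by
  have ha := hx.1
  set a := x.re with hadef
  have hE : a * Real.exp (-(a / 2)) ≤ 1 - Real.exp (-a) := by
    have h1 : a / 2 ≤ Real.sinh (a / 2) := Real.self_le_sinh_iff.2 (by linarith)
    rw [Real.sinh_eq] at h1
    have h2 : Real.exp (a / 2) * Real.exp (-(a / 2)) = 1 := by rw [← Real.exp_add]; simp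
    have h3 : Real.exp (-a) = Real.exp (-(a / 2)) * Real.exp (-(a / 2)) := by
      rw [← Real.exp_add]; congr 1; ring
    have h4 := Real.exp_pos (-(a / 2))
    nlinarith
  have hpos : 0 < 1 - Real.exp (-a) := by
    have := Real.exp_lt_one_iff.2 (show -a < 0 by linarith)
    linarith
  have h3 := norm_one_sub_ge x
  have h4 := norm_le_of_cone hx
  rw [← hadef] at h3 h4
  rw [d2, norm_mul, norm_div, Complex.norm_exp, Complex.neg_re, ← hadef, ← mul_div_assoc, norm_pow, norm_pow,
    div_le_iff₀ (by have := lt_of_lt_of_le hpos h3; positivity)]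
  have h5 : Real.exp (-a) = Real.exp (-(a / 2)) ^ 2 := by
      rw [← Real.exp_nat_mul]; congr 1; push_cast; ring
  calc ‖x‖ ^ 2 * Real.exp (-a) ≤ (2 * a) ^ 2 * Real.exp (-a) := by gcongr
    _ = 4 * (a * Real.exp (-(a / 2))) ^ 2 := by rw [h5]; ring
    _ ≤ 4 * (1 - Real.exp (-a)) ^ 2 := by gcongr
    _ ≤ _ := by gcongr

/-- `y ↦ fL (y^2 z / 2)` -/
noncomputable def hh (z : ℂ) (y : ℝ) : ℂ := fL (((y ^ 2 / 2 : ℝ) : ℂ) * z)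
noncomputable def hh1 (z : ℂ) (y : ℝ) : ℂ := d1 (((y ^ 2 / 2 : ℝ) : ℂ) * z) * (y * z)
noncomputable def hh2 (z : ℂ) (y : ℝ) : ℂ :=
  d2 (((y ^ 2 / 2 : ℝ) : ℂ) * z) * (y * z) * (y * z) + d1 (((y ^ 2 / 2 : ℝ) : ℂ) * z) * z

lemma cone_smul {z : ℂ} (hz : z ∈ cone) {r : ℝ} (hr : 0 < r) : (r : ℂ) * z ∈ cone := by
  constructor
  · rw [Complex.re_ofReal_mul]; exact mul_pos hr hz.1
  · rw [Complex.re_ofReal_mul, Complex.im_ofReal_mul, abs_mul, abs_of_pos hr]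
    exact mul_le_mul_of_nonneg_left hz.2 hr.le

lemma re_smul_pos {z : ℂ} (hz : 0 < z.re) {r : ℝ} (hr : 0 < r) : 0 < ((r : ℂ) * z).re := by
  rw [Complex.re_ofReal_mul]; exact mul_pos hr hz

lemma hasDerivAt_inner (z : ℂ) (y : ℝ) :
    HasDerivAt (fun y : ℝ => ((y ^ 2 / 2 : ℝ) : ℂ) * z) (y * z) y := by
  have h : HasDerivAt (fun y : ℝ => y ^ 2 / 2) y y := by
    have := (hasDerivAt_pow 2 y).div_const 2
    refine HasDerivAt.congr_deriv this ?_
    norm_num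
  exact (h.ofReal_comp).mul_const z

lemma hasDerivAt_hh {z : ℂ} (hz : 0 < z.re) {y : ℝ} (hy : 0 < y) :
    HasDerivAt (hh z) (hh1 z y) y := by
  have h := HasDerivAt.comp (h := fun y : ℝ => ((y ^ 2 / 2 : ℝ) : ℂ) * z) y
    (hasDerivAt_fL (re_smul_pos hz (r := y ^ 2 / 2) (by positivity)))
    (hasDerivAt_inner z y)
  exact h

lemma hasDerivAt_hh1 {z : ℂ} (hz : 0 < z.re) {y : ℝ} (hy : 0 < y) :
    HasDerivAt (hh1 z) (hh2 z y) y := by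
  have h := HasDerivAt.comp (h := fun y : ℝ => ((y ^ 2 / 2 : ℝ) : ℂ) * z) y
    (hasDerivAt_d1 (re_smul_pos hz (r := y ^ 2 / 2) (by positivity)))
    (hasDerivAt_inner z y)
  have h2 : HasDerivAt (fun y : ℝ => (y : ℂ) * z) z y := by
    have := ((hasDerivAt_id y).ofReal_comp).mul_const z
    simpa using this
  exact h.mul h2

lemma bound_hh1 {z : ℂ} (hz : z ∈ cone) {y : ℝ} (hy : 0 < y) : ‖hh1 z y‖ ≤ 4 / y := by
  have h := bound_d1 (cone_smul hz (r := y ^ 2 / 2) (by positivity))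
  have hyc : (y : ℂ) ≠ 0 := by exact_mod_cast hy.ne'
  have e : hh1 z y = (2 / y : ℝ) * ((((y ^ 2 / 2 : ℝ) : ℂ) * z) * d1 (((y ^ 2 / 2 : ℝ) : ℂ) * z)) := by
    rw [hh1]; push_cast; field_simp
  rw [e, norm_mul, Complex.norm_real, Real.norm_of_nonneg (by positivity)]
  calc 2 / y * _ ≤ 2 / y * 2 := by gcongr
    _ = _ := by ring

lemma bound_hh2 {z : ℂ} (hz : z ∈ cone) {y : ℝ} (hy : 0 < y) : ‖hh2 z y‖ ≤ 20 / y ^ 2 := by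
  have h := bound_d1 (cone_smul hz (r := y ^ 2 / 2) (by positivity))
  have h' := bound_d2 (cone_smul hz (r := y ^ 2 / 2) (by positivity))
  have hyc : (y : ℂ) ≠ 0 := by exact_mod_cast hy.ne'
  have e : hh2 z y = (1 / y ^ 2 : ℝ) * (4 * ((((y ^ 2 / 2 : ℝ) : ℂ) * z) ^ 2 * d2 (((y ^ 2 / 2 : ℝ) : ℂ) * z))
    + 2 * ((((y ^ 2 / 2 : ℝ) : ℂ) * z) * d1 (((y ^ 2 / 2 : ℝ) : ℂ) * z))) := by
    rw [hh2]; push_cast; field_simp; ring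
  rw [e, norm_mul, Complex.norm_real, Real.norm_of_nonneg (by positivity)]
  calc 1 / y ^ 2 * _ ≤ 1 / y ^ 2 * (4 * 4 + 2 * 2) := by
        gcongr
        refine (norm_add_le _ _).trans ?_
        rw [norm_mul (4:ℂ), norm_mul (2:ℂ)]
        norm_num only [Complex.norm_ofNat]
        linarith
    _ = _ := by ring

lemma midpt (h h1 h2 : ℝ → ℂ) (a y0 B : ℝ) (hy0 : y0 ∈ Set.Icc a (a + 1))
    (H1 : ∀ y ∈ Set.Icc a (a + 1), HasDerivAt h (h1 y) y)
    (H2 : ∀ y ∈ Set.Icc a (a + 1), HasDerivAt h1 (h2 y) y)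
    (HB : ∀ y ∈ Set.Icc a (a + 1), ‖h2 y‖ ≤ B) :
    ‖h y0 - ∫ y in a..(a + 1), h y‖ ≤ ‖h1 y0‖ * |a + 1 / 2 - y0| + B := by
  have hB0 : 0 ≤ B := (norm_nonneg _).trans (HB y0 hy0)
  have habs : ∀ y ∈ Set.Icc a (a + 1), ‖y - y0‖ ≤ 1 := by
    intro y hy
    rw [Real.norm_eq_abs, abs_le]
    constructor <;> linarith [hy.1, hy.2, hy0.1, hy0.2]
  have hd : ∀ y ∈ Set.Icc a (a + 1), ‖h1 y - h1 y0‖ ≤ B := by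
    intro y hy
    refine (Convex.norm_image_sub_le_of_norm_hasDerivWithin_le
      (fun x hx => (H2 x hx).hasDerivWithinAt) HB (convex_Icc _ _) hy0 hy).trans ?_
    calc B * ‖y - y0‖ ≤ B * 1 := by gcongr; exact habs y hy
      _ = B := by ring
  have hg : ∀ y ∈ Set.Icc a (a + 1), ‖h y - h y0 - h1 y0 * ((y - y0 : ℝ) : ℂ)‖ ≤ B := by
    intro y hy
    have hder : ∀ x ∈ Set.Icc a (a + 1), HasDerivWithinAt (fun y : ℝ => h y - h1 y0 * (y : ℂ)) (h1 x - h1 y0)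
        (Set.Icc a (a + 1)) x := by
      intro x hx
      have := (H1 x hx).sub ((((hasDerivAt_id x).ofReal_comp).const_mul (h1 y0)))
      simp only [id, Complex.ofReal_one, mul_one] at this
      exact this.hasDerivWithinAt
    have := Convex.norm_image_sub_le_of_norm_hasDerivWithin_le hder hd (convex_Icc _ _) hy0 hy
    have e : h y - h y0 - h1 y0 * ((y - y0 : ℝ) : ℂ) = (h y - h1 y0 * (y : ℂ)) - (h y0 - h1 y0 * (y0 : ℂ)) := by
      push_cast; ring
    rw [e]
    refine this.trans ?_
    calc B * ‖y - y0‖ ≤ B * 1 := by gcongr; exact habs y hy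
      _ = B := by ring
  have hcont : ContinuousOn h (Set.uIcc a (a + 1)) := by
    rw [Set.uIcc_of_le (by linarith)]
    exact fun x hx => (H1 x hx).continuousAt.continuousWithinAt
  have hInt0 : IntervalIntegrable h MeasureTheory.volume a (a + 1) := hcont.intervalIntegrable
  have hInt2 : IntervalIntegrable (fun y : ℝ => h1 y0 * ((y - y0 : ℝ) : ℂ)) MeasureTheory.volume a (a + 1) :=
    Continuous.intervalIntegrable (by fun_prop) _ _
  have hI2 : ∫ y in a..(a + 1), h1 y0 * ((y - y0 : ℝ) : ℂ) = h1 y0 * ((a + 1 / 2 - y0 : ℝ) : ℂ) := by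
    rw [intervalIntegral.integral_const_mul, intervalIntegral.integral_ofReal]
    congr 2
    rw [intervalIntegral.integral_sub (by simp) (by simp), integral_id]
    simp
    ring
  have hI : ∫ y in a..(a + 1), (h y - h y0 - h1 y0 * ((y - y0 : ℝ) : ℂ)) =
      (∫ y in a..(a + 1), h y) - h y0 - h1 y0 * ((a + 1 / 2 - y0 : ℝ) : ℂ) := by
    rw [intervalIntegral.integral_sub (hInt0.sub (by simp)) hInt2,
      intervalIntegral.integral_sub hInt0 (by simp), hI2]
    simp
  have hn := intervalIntegral.norm_integral_le_of_norm_le_const (a := a) (b := a + 1) (C := B)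
    (f := fun y => (h y - h y0 - h1 y0 * ((y - y0 : ℝ) : ℂ))) (by
      intro y hy
      rw [Set.uIoc_of_le (by linarith)] at hy
      exact hg y ⟨hy.1.le, hy.2⟩)
  rw [hI] at hn
  simp only [add_sub_cancel_left, abs_one, mul_one] at hn
  have e : h y0 - ∫ y in a..(a + 1), h y = -(h1 y0 * ((a + 1 / 2 - y0 : ℝ) : ℂ)) -
    ((∫ y in a..(a + 1), h y) - h y0 - h1 y0 * ((a + 1 / 2 - y0 : ℝ) : ℂ)) := by ring
  rw [e]
  refine (norm_sub_le _ _).trans ?_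
  rw [norm_neg, norm_mul, Complex.norm_real, Real.norm_eq_abs]
  linarith

/-- error terms -/
noncomputable def ee (z : ℂ) (m : ℕ) : ℂ :=
  fL ((tri m : ℂ) * z) - ∫ y in ((m : ℝ) + 1)..((m : ℝ) + 1 + 1), hh z y

lemma two_mul_tri_real (m : ℕ) : 2 * (tri m : ℝ) = ((m : ℝ) + 1) * (m + 2) := by
  exact_mod_cast two_mul_tri m

lemma tri_real_pos (m : ℕ) : 0 < (tri m : ℝ) := by
  have := two_mul_tri_real m
  have : (0:ℝ) < ((m : ℝ) + 1) * (m + 2) := by positivity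
  linarith

lemma bound_ee {z : ℂ} (hz : z ∈ cone) (m : ℕ) : ‖ee z m‖ ≤ 24 * (1 / ((m : ℝ) + 1) ^ 2) := by
  set a : ℝ := (m : ℝ) + 1 with ha
  have hapos : 0 < a := by positivity
  set y0 : ℝ := Real.sqrt (a * (a + 1)) with hy0
  have hsq : y0 ^ 2 = a * (a + 1) := Real.sq_sqrt (by positivity)
  have hy0n : 0 ≤ y0 := Real.sqrt_nonneg _
  have hl : a ≤ y0 := by
    apply abs_le_of_sq_le_sq' _ hy0n |>.2
    nlinarith
  have hr : y0 ≤ a + 1 := by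
    apply abs_le_of_sq_le_sq' _ (by linarith) |>.2
    nlinarith
  have hr2 : y0 ≤ a + 1 / 2 := by
    apply abs_le_of_sq_le_sq' _ (by linarith) |>.2
    nlinarith
  have hmid : |a + 1 / 2 - y0| ≤ 1 / a := by
    rw [abs_of_nonneg (by linarith), le_div_iff₀ hapos]
    have : (a + 1 / 2 - y0) * (a + 1 / 2 + y0) = 1 / 4 := by nlinarith
    nlinarith
  have hT : fL ((tri m : ℂ) * z) = hh z y0 := by
    rw [hh, hsq]
    congr 2
    have h := two_mul_tri_real m
    have h2 : (tri m : ℝ) = a * (a + 1) / 2 := by rw [ha]; linarith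
    rw [← h2]; simp
  rw [ee, hT]
  refine (midpt (hh z) (hh1 z) (hh2 z) a y0 (20 / a ^ 2) ⟨hl, hr⟩ ?_ ?_ ?_).trans ?_
  · intro y hy
    exact hasDerivAt_hh hz.1 (lt_of_lt_of_le hapos hy.1)
  · intro y hy
    exact hasDerivAt_hh1 hz.1 (lt_of_lt_of_le hapos hy.1)
  · intro y hy
    refine (bound_hh2 hz (lt_of_lt_of_le hapos hy.1)).trans ?_
    gcongr
    exact hy.1
  · have h1 : ‖hh1 z y0‖ ≤ 4 / a := by
      refine (bound_hh1 hz (lt_of_lt_of_le hapos hl)).trans ?_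
      gcongr
    calc ‖hh1 z y0‖ * |a + 1 / 2 - y0| + 20 / a ^ 2 ≤ 4 / a * (1 / a) + 20 / a ^ 2 := by gcongr
      _ = _ := by field_simp; norm_num

end TriPart


namespace TriPart

lemma real_mul_cpow_half {r : ℝ} (hr : 0 < r) {w : ℂ} (hw : w ≠ 0) :
    ((r : ℂ) * w) ^ (1 / 2 : ℂ) = (Real.sqrt r : ℂ) * w ^ (1 / 2 : ℂ) := by
  have hrc : (r : ℂ) ≠ 0 := by exact_mod_cast hr.ne'
  rw [Complex.cpow_def_of_ne_zero (mul_ne_zero hrc hw), Complex.cpow_def_of_ne_zero hw,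
    Complex.log_ofReal_mul hr hw, add_mul, Complex.exp_add]
  congr 1
  rw [Real.sqrt_eq_rpow, Real.rpow_def_of_pos hr]
  push_cast
  rfl

lemma rpow_three_halves {r : ℝ} (hr : 0 < r) : r ^ (-(3 / 2 : ℝ)) = (Real.sqrt r)⁻¹ * r⁻¹ := by
  rw [Real.sqrt_eq_rpow, ← Real.rpow_neg hr.le, ← Real.rpow_neg_one r, ← Real.rpow_add hr]
  norm_num

lemma summable_zeta : Summable fun m : ℕ => ((m + 1 : ℝ)) ^ (-(3 / 2 : ℝ)) := by
  have h := (Real.summable_nat_rpow (p := -(3 / 2 : ℝ))).2 (by norm_num)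
  have := (summable_nat_add_iff 1).2 h
  simpa using this

lemma zeta_pos : 0 < zetaThreeHalves :=
  summable_zeta.tsum_pos (fun m => by positivity) 0 (by positivity)

/-- the constant `√(π/2) ζ(3/2)` -/
noncomputable def cc : ℝ := Real.sqrt (2 * Real.pi) / 2 * zetaThreeHalves

lemma cc_pos : 0 < cc := by
  have := zeta_pos
  have := Real.pi_pos
  unfold cc
  positivity

lemma hasSum_hh {z : ℂ} (hz : 0 < z.re) {y : ℝ} (hy : 0 < y) :
    HasSum (fun k : ℕ => Complex.exp (-(((k + 1 : ℝ) / 2 : ℝ) * z) * (y : ℂ) ^ 2) / (k + 1 : ℝ)) (hh z y) := by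
  have h := Complex.hasSum_taylorSeries_neg_log
    (norm_exp_neg_lt (re_smul_pos hz (r := y ^ 2 / 2) (by positivity)))
  rw [← hasSum_nat_add_iff' 1] at h
  simp only [Finset.range_one, Finset.sum_singleton, Nat.cast_zero, div_zero, sub_zero] at h
  have e : (fun k : ℕ => Complex.exp (-(((k + 1 : ℝ) / 2 : ℝ) * z) * (y : ℂ) ^ 2) / (k + 1 : ℝ)) =
      fun n : ℕ => Complex.exp (-(((y ^ 2 / 2 : ℝ) : ℂ) * z)) ^ (n + 1) / ((n + 1 : ℕ) : ℂ) := by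
    funext k
    rw [← Complex.exp_nat_mul]
    push_cast
    congr 2
    ring
  rw [e]
  exact h

lemma gauss_aux {z : ℂ} (hz : 0 < z.re) :
    HasSum (fun k : ℕ => (Real.sqrt (2 * Real.pi) / 2 * ((k + 1 : ℝ)) ^ (-(3 / 2 : ℝ)) : ℝ) * (z⁻¹) ^ (1 / 2 : ℂ))
      (∫ y in Set.Ioi (0:ℝ), hh z y) := by
  have hpi := Real.pi_pos
  set F : ℕ → ℝ → ℂ := fun k y => Complex.exp (-(((k + 1 : ℝ) / 2 : ℝ) * z) * (y : ℂ) ^ 2) / (k + 1 : ℝ) with hF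
  have hb : ∀ k : ℕ, 0 < ((((k + 1 : ℝ) / 2 : ℝ) : ℂ) * z).re := fun k => re_smul_pos hz (by positivity)
  have hz0 : z ≠ 0 := by rintro rfl; simp at hz
  have hInt0 : ∀ k, MeasureTheory.Integrable (F k) (MeasureTheory.volume.restrict (Set.Ioi (0:ℝ))) := by
    intro k
    exact ((integrable_cexp_neg_mul_sq (hb k)).div_const _).integrableOn
  have hsq : ∀ k : ℕ, Real.sqrt (k + 1) ≠ 0 := fun k => (Real.sqrt_pos.2 (by positivity)).ne'
  have hnorm : Summable fun k => ∫ y in Set.Ioi (0:ℝ), ‖F k y‖ := by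
    have e : ∀ k : ℕ, ∫ y in Set.Ioi (0:ℝ), ‖F k y‖ = (Real.sqrt (2 * Real.pi / z.re) / 2) * ((k + 1 : ℝ)) ^ (-(3 / 2 : ℝ)) := by
      intro k
      have : ∀ y : ℝ, ‖F k y‖ = Real.exp (-(((k + 1 : ℝ) / 2 : ℝ) * z.re) * y ^ 2) / (k + 1 : ℝ) := by
        intro y
        simp only [hF]
        rw [norm_div, norm_cexp_neg_mul_sq, Complex.re_ofReal_mul, Complex.norm_real, Real.norm_of_nonneg (by positivity)]
      simp_rw [this]
      rw [MeasureTheory.integral_div, integral_gaussian_Ioi, rpow_three_halves (by positivity)]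
      have : Real.pi / ((k + 1 : ℝ) / 2 * z.re) = (2 * Real.pi / z.re) / (k + 1) := by field_simp
      rw [this, Real.sqrt_div (by positivity)]
      have := hsq k
      field_simp
    simp_rw [e]
    exact summable_zeta.mul_left _
  have h := MeasureTheory.hasSum_integral_of_summable_integral_norm hInt0 hnorm
  have e1 : ∫ y in Set.Ioi (0:ℝ), ∑' k, F k y = ∫ y in Set.Ioi (0:ℝ), hh z y := by
    apply MeasureTheory.setIntegral_congr_fun measurableSet_Ioi
    intro y hy
    exact (hasSum_hh hz hy).tsum_eq
  rw [e1] at h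
  have e2aux : ∀ k : ℕ, ((Real.sqrt (2 * Real.pi) / 2 * ((k + 1 : ℝ)) ^ (-(3 / 2 : ℝ)) : ℝ) : ℂ) * (z⁻¹) ^ (1 / 2 : ℂ)
      = ∫ y in Set.Ioi (0:ℝ), F k y := by
    intro k
    simp only [hF]
    rw [MeasureTheory.integral_div, integral_gaussian_complex_Ioi (hb k), rpow_three_halves (by positivity)]
    have : (Real.pi : ℂ) / ((((k + 1 : ℝ) / 2 : ℝ) : ℂ) * z) = ((2 * Real.pi / (k + 1) : ℝ) : ℂ) * z⁻¹ := by
      push_cast; field_simp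
    rw [this, real_mul_cpow_half (by positivity) (inv_ne_zero hz0), Real.sqrt_div (by positivity)]
    have h1 : ((Real.sqrt (k + 1) : ℝ) : ℂ) ≠ 0 := by exact_mod_cast hsq k
    have h2 : ((k : ℂ) + 1) ≠ 0 := by exact_mod_cast Nat.succ_ne_zero k
    push_cast
    field_simp
  have e2 : (fun k : ℕ => (Real.sqrt (2 * Real.pi) / 2 * ((k + 1 : ℝ)) ^ (-(3 / 2 : ℝ)) : ℝ) * (z⁻¹) ^ (1 / 2 : ℂ))
      = fun k => ∫ y in Set.Ioi (0:ℝ), F k y := by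
    funext k
    exact e2aux k
  rw [e2]
  exact h

lemma integral_hh {z : ℂ} (hz : 0 < z.re) :
    ∫ y in Set.Ioi (0:ℝ), hh z y = (cc : ℂ) * (z⁻¹) ^ (1 / 2 : ℂ) := by
  have h := gauss_aux hz
  have h2 : HasSum (fun k : ℕ => (Real.sqrt (2 * Real.pi) / 2 * ((k + 1 : ℝ)) ^ (-(3 / 2 : ℝ)) : ℝ) )
      cc := summable_zeta.hasSum.mul_left _
  have h3 := (Complex.hasSum_ofReal.2 h2).mul_right ((z⁻¹) ^ (1 / 2 : ℂ))
  exact h.unique h3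

lemma integrable_hh {z : ℂ} (hz : 0 < z.re) : MeasureTheory.IntegrableOn (hh z) (Set.Ioi 0) := by
  apply MeasureTheory.Integrable.of_integral_ne_zero
  rw [integral_hh hz]
  have hz0 : z ≠ 0 := by rintro rfl; simp at hz
  apply mul_ne_zero
  · exact_mod_cast cc_pos.ne'
  · rw [Complex.cpow_def_of_ne_zero (inv_ne_zero hz0)]
    exact Complex.exp_ne_zero _

lemma intervalIntegrable_hh {z : ℂ} (hz : 0 < z.re) {a b : ℝ} (ha : 0 ≤ a) (hab : a ≤ b) :
    IntervalIntegrable (hh z) MeasureTheory.volume a b := by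
  rw [intervalIntegrable_iff_integrableOn_Ioc_of_le hab]
  exact (integrable_hh hz).mono_set (fun y hy => lt_of_le_of_lt ha hy.1)

lemma q_tendsto : Tendsto (fun x => fL x + Complex.log x) (𝓝[{x : ℂ | 0 < x.re}] 0) (𝓝 0) := by
  have h1 : HasDerivAt (fun x : ℂ => 1 - Complex.exp (-x)) 1 0 := by
    have := ((hasDerivAt_neg (0:ℂ)).cexp).const_sub 1
    simpa using this
  have h2 := h1.tendsto_slope
  have h3 : Tendsto (fun x : ℂ => (1 - Complex.exp (-x)) / x) (𝓝[{x : ℂ | 0 < x.re}] 0) (𝓝 1) := by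
    refine (h2.mono_left (nhdsWithin_mono _ ?_)).congr ?_
    · rintro x hx rfl
      simp at hx
    · intro x
      simp [slope_def_field]
  have h4 : Tendsto (fun x : ℂ => Complex.log ((1 - Complex.exp (-x)) / x)) (𝓝[{x : ℂ | 0 < x.re}] 0) (𝓝 0) := by
    have := h3.clog (by simp)
    simpa using this
  have h5 := h4.neg
  rw [neg_zero] at h5
  refine h5.congr' ?_
  have hre : ∀ᶠ x in 𝓝[{x : ℂ | 0 < x.re}] 0, 0 < ((1 - Complex.exp (-x)) / x).re := by
    have : Tendsto (fun x : ℂ => ((1 - Complex.exp (-x)) / x).re) (𝓝[{x : ℂ | 0 < x.re}] 0) (𝓝 1) :=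
      (Complex.continuous_re.tendsto 1).comp h3
    exact this.eventually_const_lt (by norm_num)
  filter_upwards [hre, self_mem_nhdsWithin] with x hx1 hx2
  have hx0 : x ≠ 0 := by rintro rfl; simp at hx2
  have hq0 : (1 - Complex.exp (-x)) / x ≠ 0 := by intro h; rw [h] at hx1; simp at hx1
  have ha1 := abs_lt.1 (Complex.abs_arg_lt_pi_div_two_iff.2 (Or.inl hx1))
  have ha2 := abs_lt.1 (Complex.abs_arg_lt_pi_div_two_iff.2 (Or.inl hx2))
  have : Complex.log (1 - Complex.exp (-x)) = Complex.log (x * ((1 - Complex.exp (-x)) / x)) := by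
    congr 1; field_simp
  rw [fL, this, Complex.log_mul hx0 hq0 ⟨by linarith [ha1.1, ha2.1], by linarith [ha1.2, ha2.2]⟩]
  ring

/-- limit filter -/
noncomputable def lc : Filter ℂ := 𝓝[cone] 0

lemma lc_cone : ∀ᶠ z in lc, z ∈ cone := self_mem_nhdsWithin

lemma fL_tendsto {r : ℝ} (hr : 0 < r) :
    Tendsto (fun z => fL ((r : ℂ) * z) + Complex.log z) lc (𝓝 (-(Real.log r : ℂ))) := by
  have h : Tendsto (fun z : ℂ => (r : ℂ) * z) lc (𝓝[{x : ℂ | 0 < x.re}] 0) := by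
    apply tendsto_nhdsWithin_of_tendsto_nhds_of_eventually_within
    · have : Tendsto (fun z : ℂ => (r : ℂ) * z) (𝓝 0) (𝓝 ((r : ℂ) * 0)) := by
        apply Continuous.tendsto; fun_prop
      rw [mul_zero] at this
      exact this.mono_left nhdsWithin_le_nhds
    · filter_upwards [lc_cone] with z hz
      exact re_smul_pos hz.1 hr
  have h2 := (q_tendsto.comp h).sub_const (Real.log r : ℂ)
  rw [zero_sub] at h2
  refine h2.congr' ?_
  filter_upwards [lc_cone] with z hz
  have hz0 : z ≠ 0 := by rintro rfl; simpa using hz.1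
  simp only [Function.comp]
  rw [Complex.log_ofReal_mul hr hz0]
  ring

/-- `log (y^2/2)` -/
noncomputable def ll (y : ℝ) : ℝ := 2 * Real.log y - Real.log 2

lemma ll_eq {y : ℝ} (hy : 0 < y) : ll y = Real.log (y ^ 2 / 2) := by
  rw [ll, Real.log_div (by positivity) (by norm_num), Real.log_pow]; norm_num

lemma ll_int (a b : ℝ) : IntervalIntegrable ll MeasureTheory.volume a b := by
  unfold ll
  exact (intervalIntegral.intervalIntegrable_log'.const_mul 2).sub (by simp)

lemma ll_integral (a b : ℝ) : ∫ y in a..b, ll y =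
    2 * (b * Real.log b - a * Real.log a - b + a) - (b - a) * Real.log 2 := by
  unfold ll
  rw [intervalIntegral.integral_sub (intervalIntegral.intervalIntegrable_log'.const_mul 2) (by simp),
    intervalIntegral.integral_const_mul, integral_log, intervalIntegral.integral_const, smul_eq_mul]

lemma int_tendsto {a b : ℝ} (ha : 0 ≤ a) (hab : a ≤ b) :
    Tendsto (fun z => (∫ y in a..b, hh z y) + ((b - a : ℝ) : ℂ) * Complex.log z) lc
      (𝓝 (-((∫ y in a..b, ll y : ℝ) : ℂ))) := by
  rw [Metric.tendsto_nhds]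
  intro ε hε
  have hq := Metric.tendsto_nhds.1 q_tendsto (ε / (b - a + 1)) (by
    have : 0 < b - a + 1 := by linarith
    positivity)
  rw [eventually_nhdsWithin_iff, Metric.eventually_nhds_iff] at hq
  obtain ⟨δ, hδ, hq⟩ := hq
  have hsmall : ∀ᶠ z in lc, ‖z‖ < δ / (b ^ 2 / 2 + 1) := by
    have : Tendsto (fun z : ℂ => ‖z‖) lc (𝓝 0) := by
      have : Tendsto (fun z : ℂ => ‖z‖) (𝓝 0) (𝓝 ‖(0:ℂ)‖) := continuous_norm.tendsto 0
      rw [norm_zero] at this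
      exact this.mono_left nhdsWithin_le_nhds
    exact this.eventually_lt_const (by positivity)
  filter_upwards [lc_cone, hsmall] with z hz hzs
  have hz0 : z ≠ 0 := by rintro rfl; simpa using hz.1
  have hi1 := intervalIntegrable_hh hz.1 ha hab
  have hi2 : IntervalIntegrable (fun y => (ll y : ℂ)) MeasureTheory.volume a b := ⟨(ll_int a b).1.ofReal, (ll_int a b).2.ofReal⟩
  have e : (∫ y in a..b, hh z y) + ((b - a : ℝ) : ℂ) * Complex.log z - (-((∫ y in a..b, ll y : ℝ) : ℂ))
      = ∫ y in a..b, (hh z y + Complex.log z + (ll y : ℂ)) := by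
    rw [intervalIntegral.integral_add (hi1.add (by simp)) hi2, intervalIntegral.integral_add hi1 (by simp),
      intervalIntegral.integral_ofReal, intervalIntegral.integral_const, Complex.real_smul]
    ring
  rw [dist_eq_norm, e]
  have hb1 : 0 < b - a + 1 := by linarith
  have := intervalIntegral.norm_integral_le_of_norm_le_const (a := a) (b := b) (C := ε / (b - a + 1))
    (f := fun y => hh z y + Complex.log z + (ll y : ℂ)) (by
      intro y hy
      rw [Set.uIoc_of_le hab] at hy
      have hy0 : 0 < y := lt_of_le_of_lt ha hy.1
      have hlt : ‖((y ^ 2 / 2 : ℝ) : ℂ) * z‖ < δ := by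
        rw [norm_mul, Complex.norm_real, Real.norm_of_nonneg (by positivity)]
        rw [lt_div_iff₀ (by positivity)] at hzs
        have : y ^ 2 ≤ b ^ 2 := by gcongr; exact hy.2
        nlinarith [norm_nonneg z]
      have := hq (y := ((y ^ 2 / 2 : ℝ) : ℂ) * z) (by simpa [dist_eq_norm] using hlt) (re_smul_pos hz.1 (by positivity))
      rw [dist_eq_norm, sub_zero, Complex.log_ofReal_mul (by positivity) hz0, ← ll_eq hy0] at this
      rw [hh]
      refine le_trans (le_of_eq ?_) this.le
      congr 1
      ring)
  refine lt_of_le_of_lt this ?_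
  rw [abs_of_nonneg (by linarith), div_mul_eq_mul_div, div_lt_iff₀ hb1]
  nlinarith

/-- limit of the error terms -/
noncomputable def e0 (m : ℕ) : ℝ := -Real.log (tri m) + ∫ y in ((m : ℝ) + 1)..((m : ℝ) + 1 + 1), ll y

lemma ee_tendsto (m : ℕ) : Tendsto (fun z => ee z m) lc (𝓝 (e0 m : ℂ)) := by
  have h1 := fL_tendsto (tri_real_pos m)
  have h2 := int_tendsto (a := (m : ℝ) + 1) (b := (m : ℝ) + 1 + 1) (by positivity) (by linarith)
  have h3 := h1.sub h2
  have e : (-(Real.log (tri m) : ℂ) - -((∫ y in ((m : ℝ) + 1)..((m : ℝ) + 1 + 1), ll y : ℝ) : ℂ)) = (e0 m : ℂ) := by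
    rw [e0]; push_cast; ring
  rw [e] at h3
  refine h3.congr ?_
  intro z
  rw [ee]
  simp only [add_sub_cancel_left, Complex.ofReal_one, Complex.ofReal_natCast]
  ring

lemma tendsto_real_lc : Tendsto (fun t : ℝ => (t : ℂ)) (𝓝[>] 0) lc := by
  apply tendsto_nhdsWithin_of_tendsto_nhds_of_eventually_within
  · have : Tendsto (fun t : ℝ => (t : ℂ)) (𝓝 0) (𝓝 ((0:ℝ) : ℂ)) := Complex.continuous_ofReal.tendsto 0
    rw [Complex.ofReal_zero] at this
    exact this.mono_left nhdsWithin_le_nhds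
  · filter_upwards [self_mem_nhdsWithin] with t ht
    exact ⟨by simpa using ht, by simpa using (le_of_lt ht)⟩

instance : lc.NeBot := tendsto_real_lc.neBot

lemma summable_sq : Summable fun m : ℕ => 24 * (1 / ((m : ℝ) + 1) ^ 2) := by
  have h := (Real.summable_one_div_nat_pow (p := 2)).2 (by norm_num)
  have := (summable_nat_add_iff 1).2 h
  apply Summable.mul_left
  simpa using this

lemma e0_bound (m : ℕ) : ‖e0 m‖ ≤ 24 * (1 / ((m : ℝ) + 1) ^ 2) := by
  have h := (ee_tendsto m).norm
  rw [Complex.norm_real] at h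
  apply le_of_tendsto h
  filter_upwards [lc_cone] with z hz
  exact bound_ee hz m

lemma sum_log_tri (M : ℕ) : ∑ m ∈ Finset.range M, Real.log (tri m) =
    2 * Real.log ((M + 1).factorial) - Real.log (M + 1) - M * Real.log 2 := by
  induction M with
  | zero => simp
  | succ M ih =>
    rw [Finset.sum_range_succ, ih]
    have h := two_mul_tri_real M
    have h2 : (tri M : ℝ) = ((M : ℝ) + 1) * (M + 2) / 2 := by linarith
    rw [h2, Real.log_div (by positivity) (by norm_num), Real.log_mul (by positivity) (by positivity),
      Nat.factorial_succ (M + 1)]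
    push_cast
    rw [Real.log_mul (by positivity) (by positivity)]
    have : (M : ℝ) + 1 + 1 = M + 2 := by ring
    rw [this]
    ring

lemma e0_sum : (∫ y in (0:ℝ)..1, ll y) + ∑' m, e0 m = -Real.log (4 * Real.pi) := by
  have hs : Summable e0 := Summable.of_norm_bounded summable_sq e0_bound
  have h1 := (hs.hasSum.tendsto_sum_nat).const_add (∫ y in (0:ℝ)..1, ll y)
  refine tendsto_nhds_unique h1 ?_
  have h2 : Tendsto (fun M : ℕ => -2 * Real.log (Stirling.stirlingSeq (M + 1)) - 2 * Real.log 2) atTop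
      (𝓝 (-2 * Real.log (Real.sqrt Real.pi) - 2 * Real.log 2)) := by
    apply Tendsto.sub_const
    apply Tendsto.const_mul
    apply Tendsto.log _ (Real.sqrt_pos.2 Real.pi_pos).ne'
    exact Stirling.tendsto_stirlingSeq_sqrt_pi.comp (tendsto_add_atTop_nat 1)
  have e : -2 * Real.log (Real.sqrt Real.pi) - 2 * Real.log 2 = -Real.log (4 * Real.pi) := by
    rw [Real.log_sqrt Real.pi_pos.le, Real.log_mul (by norm_num) Real.pi_pos.ne',
      show (4:ℝ) = 2 ^ 2 by norm_num, Real.log_pow]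
    push_cast; ring
  rw [e] at h2
  refine h2.congr ?_
  intro M
  have hsum : ∑ m ∈ Finset.range M, e0 m = -(∑ m ∈ Finset.range M, Real.log (tri m)) +
      ∫ y in (1:ℝ)..((M : ℝ) + 1), ll y := by
    simp only [e0]
    rw [Finset.sum_add_distrib, Finset.sum_neg_distrib]
    congr 1
    have := intervalIntegral.sum_integral_adjacent_intervals (f := ll) (μ := MeasureTheory.volume)
      (a := fun m : ℕ => (m : ℝ) + 1) (n := M) (fun k _ => ll_int _ _)
    push_cast at this
    rw [this]
    norm_num
  rw [hsum, sum_log_tri, ll_integral, ll_integral, Stirling.log_stirlingSeq_formula]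
  push_cast
  have hM : (0:ℝ) < (M : ℝ) + 1 := by positivity
  rw [Real.log_div hM.ne' (Real.exp_ne_zero _), Real.log_exp, Real.log_mul (by norm_num) hM.ne']
  simp
  ring

/-- log of the generating function -/
noncomputable def LF (z : ℂ) : ℂ := ∑' m, fL ((tri m : ℂ) * z)

lemma summable_fL {z : ℂ} (hz : 0 < z.re) : Summable fun m => fL ((tri m : ℂ) * z) := by
  have h : Summable fun m : ℕ => -Complex.exp (-((tri m : ℂ) * z)) := by
    apply Summable.neg
    apply Summable.of_norm_bounded (g := fun m : ℕ => Real.exp (-z.re) ^ m)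
    · apply summable_geometric_of_lt_one (Real.exp_pos _).le
      exact Real.exp_lt_one_iff.2 (by linarith)
    · intro m
      rw [Complex.norm_exp, ← Real.exp_nat_mul]
      apply Real.exp_le_exp.2
      have h1 : (m : ℝ) ≤ tri m := by exact_mod_cast (Nat.le_succ m).trans (le_tri m)
      have h2 : ((tri m : ℂ) * z).re = tri m * z.re := by
        have := Complex.re_ofReal_mul (tri m : ℝ) z
        simpa using this
      rw [Complex.neg_re, h2]
      nlinarith
  have := (Complex.summable_log_one_add_of_summable h).neg
  refine this.congr ?_
  intro m
  rw [fL, sub_eq_add_neg]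

lemma LF_eq {z : ℂ} (hz : z ∈ cone) :
    LF z = (cc : ℂ) * (z⁻¹) ^ (1 / 2 : ℂ) - (∫ y in (0:ℝ)..1, hh z y) + ∑' m, ee z m := by
  have h1 := (summable_fL hz.1).hasSum.tendsto_sum_nat
  have hs : Summable (ee z) := Summable.of_norm_bounded summable_sq (bound_ee hz)
  have h2 := hs.hasSum.tendsto_sum_nat
  have h3 : Tendsto (fun M : ℕ => ∫ y in (0:ℝ)..((M : ℝ) + 1), hh z y) atTop (𝓝 (∫ y in Set.Ioi (0:ℝ), hh z y)) := by
    apply MeasureTheory.intervalIntegral_tendsto_integral_Ioi 0 (integrable_hh hz.1)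
    exact tendsto_atTop_add_const_right _ _ tendsto_natCast_atTop_atTop
  rw [integral_hh hz.1] at h3
  refine tendsto_nhds_unique h1 (((h3.sub_const (∫ y in (0:ℝ)..1, hh z y)).add h2).congr ?_)
  intro M
  have hsum : ∑ m ∈ Finset.range M, ∫ y in ((m : ℝ) + 1)..((m : ℝ) + 1 + 1), hh z y =
      ∫ y in (1:ℝ)..((M : ℝ) + 1), hh z y := by
    have := intervalIntegral.sum_integral_adjacent_intervals (f := hh z) (μ := MeasureTheory.volume)
      (a := fun m : ℕ => (m : ℝ) + 1) (n := M)
      (fun k _ => intervalIntegrable_hh hz.1 (by positivity) (by push_cast; linarith))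
    push_cast at this
    rw [this]
    norm_num
  have hadd := intervalIntegral.integral_add_adjacent_intervals
    (intervalIntegrable_hh hz.1 (le_refl 0) zero_le_one)
    (intervalIntegrable_hh hz.1 zero_le_one (show (1:ℝ) ≤ (M : ℝ) + 1 by linarith [Nat.cast_nonneg (α := ℝ) M]))
  simp only [ee]
  rw [Finset.sum_sub_distrib, hsum, ← hadd]
  ring

theorem LF_tendsto : Tendsto (fun z => LF z - (cc : ℂ) * (z⁻¹) ^ (1 / 2 : ℂ) - Complex.log z) lc
    (𝓝 ((-Real.log (4 * Real.pi) : ℝ) : ℂ)) := by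
  have h1 : Tendsto (fun z => ∑' m, ee z m) lc (𝓝 (∑' m, (e0 m : ℂ))) := by
    apply tendsto_tsum_of_dominated_convergence summable_sq ee_tendsto
    filter_upwards [lc_cone] with z hz
    exact bound_ee hz
  have h2 := int_tendsto (a := 0) (b := 1) le_rfl zero_le_one
  have h3 := h1.sub h2
  rw [sub_neg_eq_add, ← Complex.ofReal_tsum, ← Complex.ofReal_add, add_comm, e0_sum] at h3
  refine h3.congr' ?_
  filter_upwards [lc_cone] with z hz
  rw [LF_eq hz]
  push_cast
  ring

end TriPart

namespace TriPart

lemma arc_term {t : ℝ} (u : ℝ) (ht : 0 < t) :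
    (fL ((t : ℂ) + u * Complex.I)).re - (fL (t : ℂ)).re ≤ -(Real.exp (-t) * (1 - Real.cos u) / 5) := by
  set r := Real.exp (-t) with hr
  have hr0 : 0 < r := Real.exp_pos _
  have hr1 : r < 1 := by rw [hr, Real.exp_lt_one_iff]; linarith
  have hc1 := Real.cos_le_one u
  have hc2 := Real.neg_one_le_cos u
  have e0 : Complex.exp (-(t : ℂ)) = (r : ℂ) := by rw [hr]; push_cast; rfl
  have e1 : ‖1 - Complex.exp (-((t : ℂ) + u * Complex.I))‖ ^ 2 = (1 - r) ^ 2 + 2 * r * (1 - Real.cos u) := by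
    rw [neg_add, Complex.exp_add, e0, ← neg_mul, ← Complex.ofReal_neg, Complex.exp_mul_I,
      ← Complex.ofReal_cos, ← Complex.ofReal_sin, Complex.sq_norm, Complex.normSq_apply]
    simp only [Complex.sub_re, Complex.sub_im, Complex.one_re, Complex.one_im, Complex.mul_re, Complex.mul_im,
      Complex.add_re, Complex.add_im, Complex.ofReal_re, Complex.ofReal_im, Complex.I_re, Complex.I_im,
      Real.cos_neg, Real.sin_neg]
    have := Real.sin_sq_add_cos_sq u
    linear_combination r ^ 2 * this
  have e2 : ‖1 - Complex.exp (-(t : ℂ))‖ = 1 - r := by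
    rw [e0, ← Complex.ofReal_one, ← Complex.ofReal_sub, Complex.norm_real, Real.norm_of_nonneg (by linarith)]
  simp only [fL, Complex.neg_re, Complex.log_re]
  rw [e2]
  set N := ‖1 - Complex.exp (-((t : ℂ) + u * Complex.I))‖ with hN
  have hNp : 0 < N ^ 2 := by rw [e1]; nlinarith [mul_nonneg hr0.le (by linarith : 0 ≤ 1 - Real.cos u), mul_pos (by linarith : 0 < 1 - r) (by linarith : 0 < 1 - r)]
  have h1 : Real.log (N ^ 2) = 2 * Real.log N := by simp
  have h2 : Real.log ((1 - r) ^ 2) = 2 * Real.log (1 - r) := by simp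
  set x := 2 * r * (1 - Real.cos u) with hx
  have hx0 : 0 ≤ x := by
    have : 0 ≤ 1 - Real.cos u := by linarith
    positivity
  have hx4 : x ≤ 4 := by nlinarith
  have h3 : Real.log ((1 - r) ^ 2) + Real.log (1 + x) ≤ Real.log (N ^ 2) := by
    rw [← Real.log_mul (by nlinarith) (by linarith)]
    apply Real.log_le_log
    · have : 0 < 1 - r := by linarith
      positivity
    · rw [e1]
      have : (1 - r) ^ 2 ≤ 1 := by nlinarith
      nlinarith [mul_le_mul_of_nonneg_right this hx0]
  have h4 : x / 5 ≤ Real.log (1 + x) := by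
    have := Real.one_sub_inv_le_log_of_pos (by linarith : 0 < 1 + x)
    have h5 : 1 - (1 + x)⁻¹ = x / (1 + x) := by field_simp; ring
    have h6 : x / 5 ≤ x / (1 + x) := div_le_div_of_nonneg_left hx0 (by linarith) (by linarith)
    linarith
  linarith

lemma arc_sum {t : ℝ} (u : ℝ) (ht : 0 < t) (M : ℕ) :
    (LF ((t : ℂ) + u * Complex.I)).re - (LF (t : ℂ)).re ≤
      -(∑ m ∈ Finset.range M, Real.exp (-(tri m * t)) * (1 - Real.cos (tri m * u))) / 5 := by
  have s1 := summable_fL (z := (t : ℂ) + u * Complex.I) (by simpa using ht)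
  have s2 := summable_fL (z := (t : ℂ)) (by simpa using ht)
  have h1 := (Complex.hasSum_re s1.hasSum).sub (Complex.hasSum_re s2.hasSum)
  have hterm : ∀ m : ℕ, (fL ((tri m : ℂ) * ((t : ℂ) + u * Complex.I))).re - (fL ((tri m : ℂ) * (t : ℂ))).re
      ≤ -(Real.exp (-(tri m * t)) * (1 - Real.cos (tri m * u)) / 5) := by
    intro m
    have := arc_term (t := tri m * t) (tri m * u) (mul_pos (tri_real_pos m) ht)
    convert this using 4
    · push_cast; ring
    · push_cast; ring
  have hneg : ∀ m : ℕ, (fL ((tri m : ℂ) * ((t : ℂ) + u * Complex.I))).re - (fL ((tri m : ℂ) * (t : ℂ))).re ≤ 0 := by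
    intro m
    refine (hterm m).trans ?_
    have : 0 ≤ 1 - Real.cos (tri m * u) := by linarith [Real.cos_le_one (tri m * u)]
    have : 0 ≤ Real.exp (-(tri m * t)) * (1 - Real.cos (tri m * u)) := by positivity
    linarith
  have h2 := sum_le_hasSum (Finset.range M) (fun m _ => by simpa using hneg m) h1.neg
  have h3 : (LF ((t : ℂ) + u * Complex.I)).re - (LF (t : ℂ)).re ≤
    ∑ m ∈ Finset.range M, ((fL ((tri m : ℂ) * ((t : ℂ) + u * Complex.I))).re - (fL ((tri m : ℂ) * (t : ℂ))).re) := by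
    rw [Finset.sum_neg_distrib] at h2
    unfold LF
    linarith
  refine h3.trans ((Finset.sum_le_sum fun m _ => hterm m).trans (le_of_eq ?_))
  rw [Finset.sum_neg_distrib, neg_div, Finset.sum_div]

lemma one_sub_cos_eq (x : ℝ) : 1 - Real.cos x = 2 * |Real.sin (x / 2)| ^ 2 := by
  have h := Real.cos_two_mul (x / 2)
  have h2 := Real.sin_sq_add_cos_sq (x / 2)
  rw [show 2 * (x / 2) = x by ring] at h
  rw [sq_abs]
  linarith

lemma abs_sin_add_le (x y : ℝ) : |Real.sin (x + y)| ≤ |Real.sin x| + |Real.sin y| := by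
  rw [Real.sin_add]
  refine (abs_add_le _ _).trans ?_
  rw [abs_mul, abs_mul]
  have h1 := Real.abs_cos_le_one x
  have h2 := Real.abs_cos_le_one y
  have h3 := abs_nonneg (Real.sin x)
  have h4 := abs_nonneg (Real.sin y)
  nlinarith

lemma cos_diff (a b c : ℝ) : 1 - Real.cos (a - 2 * b + c) ≤
    6 * ((1 - Real.cos a) + (1 - Real.cos b) + (1 - Real.cos c)) := by
  simp only [one_sub_cos_eq]
  set A := |Real.sin (a / 2)|
  set B := |Real.sin (b / 2)| with hB
  set C := |Real.sin (c / 2)|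
  have hS : |Real.sin ((a - 2 * b + c) / 2)| ≤ A + 2 * B + C := by
    have e : (a - 2 * b + c) / 2 = (a / 2 + c / 2) + (-(b / 2) + -(b / 2)) := by ring
    rw [e]
    have h1 := abs_sin_add_le (a / 2 + c / 2) (-(b / 2) + -(b / 2))
    have h2 := abs_sin_add_le (a / 2) (c / 2)
    have h3 := abs_sin_add_le (-(b / 2)) (-(b / 2))
    rw [Real.sin_neg, abs_neg, ← hB] at h3
    linarith
  have h0 := abs_nonneg (Real.sin ((a - 2 * b + c) / 2))
  have : |Real.sin ((a - 2 * b + c) / 2)| ^ 2 ≤ (A + 2 * B + C) ^ 2 := by gcongr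
  nlinarith [sq_nonneg (2 * A - B), sq_nonneg (A - C), sq_nonneg (2 * C - B)]

lemma tri_diff (j h : ℕ) : (tri (j + 2 * h) : ℝ) - 2 * tri (j + h) + tri j = (h : ℝ) ^ 2 := by
  have h1 := two_mul_tri_real (j + 2 * h)
  have h2 := two_mul_tri_real (j + h)
  have h3 := two_mul_tri_real j
  push_cast at h1 h2 h3
  nlinarith

lemma cos_sum (u : ℝ) (h M : ℕ) (hM : 2 * h ≤ M) :
    ((M : ℝ) - 2 * h) * (1 - Real.cos ((h : ℝ) ^ 2 * u)) / 18 ≤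
      ∑ m ∈ Finset.range M, (1 - Real.cos (tri m * u)) := by
  obtain ⟨N, rfl⟩ := Nat.exists_eq_add_of_le hM
  set a : ℕ → ℝ := fun m => 1 - Real.cos (tri m * u) with ha
  have a0 : ∀ m, 0 ≤ a m := fun m => by simp only [ha]; linarith [Real.cos_le_one (tri m * u)]
  have hk : ∀ k, k ≤ 2 * h → ∑ j ∈ Finset.range N, a (j + k) ≤ ∑ m ∈ Finset.range (2 * h + N), a m := by
    intro k hk
    have : ∑ j ∈ Finset.range N, a (j + k) = ∑ m ∈ (Finset.range N).map (addRightEmbedding k), a m := by simp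
    rw [this]
    apply Finset.sum_le_sum_of_subset_of_nonneg
    · intro x hx
      simp at hx ⊢
      obtain ⟨y, hy, rfl⟩ := hx
      omega
    · intro i _ _; exact a0 i
  have h1 : ∑ j ∈ Finset.range N, (1 - Real.cos ((h : ℝ) ^ 2 * u)) ≤
      ∑ j ∈ Finset.range N, 6 * (a (j + 2 * h) + a (j + h) + a (j + 0)) := by
    apply Finset.sum_le_sum
    intro j _
    have := cos_diff (tri (j + 2 * h) * u) (tri (j + h) * u) (tri j * u)
    rw [show (tri (j + 2 * h) : ℝ) * u - 2 * (tri (j + h) * u) + tri j * u = (h : ℝ) ^ 2 * u by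
      rw [← tri_diff j h]; ring] at this
    exact this
  rw [Finset.sum_const, ← Finset.mul_sum, Finset.sum_add_distrib, Finset.sum_add_distrib] at h1
  simp only [Finset.card_range, nsmul_eq_mul] at h1
  have := hk (2 * h) le_rfl
  have := hk h (by omega)
  have := hk 0 (by omega)
  push_cast
  rw [show (2 * (h : ℝ) + N - 2 * h) = N by ring]
  linarith

lemma arc_h {t : ℝ} (u : ℝ) (ht : 0 < t) (h M : ℕ) (hM : 4 * h ≤ M) (hMt : (M : ℝ) ^ 2 * t ≤ 1) :
    (LF ((t : ℂ) + u * Complex.I)).re - (LF (t : ℂ)).re ≤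
      -((M : ℝ) / 540 * (1 - Real.cos ((h : ℝ) ^ 2 * u))) := by
  refine (arc_sum u ht M).trans ?_
  have h1 := cos_sum u h M (by omega)
  have h2 : ∑ m ∈ Finset.range M, (1 / 3) * (1 - Real.cos (tri m * u)) ≤
      ∑ m ∈ Finset.range M, Real.exp (-(tri m * t)) * (1 - Real.cos (tri m * u)) := by
    apply Finset.sum_le_sum
    intro m hm
    have hc : 0 ≤ 1 - Real.cos (tri m * u) := by linarith [Real.cos_le_one (tri m * u)]
    apply mul_le_mul_of_nonneg_right _ hc
    have hm : (m : ℝ) + 1 ≤ M := by exact_mod_cast Finset.mem_range.1 hm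
    have hT : (tri m : ℝ) ≤ (M : ℝ) ^ 2 := by
      have := two_mul_tri_real m
      have hm0 : (0:ℝ) ≤ m := by positivity
      nlinarith
    have : (tri m : ℝ) * t ≤ 1 := (mul_le_mul_of_nonneg_right hT ht.le).trans hMt
    have h3 : Real.exp (-1) ≤ Real.exp (-(tri m * t)) := Real.exp_le_exp.2 (by linarith)
    have h4 := Real.exp_neg_one_gt_d9
    linarith
  rw [← Finset.mul_sum] at h2
  have h5 : 0 ≤ 1 - Real.cos ((h : ℝ) ^ 2 * u) := by linarith [Real.cos_le_one ((h : ℝ) ^ 2 * u)]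
  have h6 : (4 * h : ℝ) ≤ M := by exact_mod_cast hM
  have h7 : (M : ℝ) / 2 * (1 - Real.cos ((h : ℝ) ^ 2 * u)) ≤ ((M : ℝ) - 2 * h) * (1 - Real.cos ((h : ℝ) ^ 2 * u)) :=
    mul_le_mul_of_nonneg_right (by linarith) h5
  linarith

theorem arc {t u : ℝ} (ht : 0 < t) (ht1 : t ≤ 1 / 16) (hu : |u| ≤ Real.pi) :
    (LF ((t : ℂ) + u * Complex.I)).re - (LF (t : ℂ)).re ≤
      -(1 / 10 ^ 9 * (Real.sqrt t)⁻¹ * min 1 ((u / t) ^ 2)) := by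
  have hpi := Real.pi_pos
  have hpi2 : Real.pi ^ 2 < 10 := by nlinarith [Real.pi_lt_d2]
  set s := Real.sqrt t with hs
  have hs0 : 0 < s := Real.sqrt_pos.2 ht
  have hst : s ^ 2 = t := Real.sq_sqrt ht.le
  have hs4 : s ≤ 1 / 4 := by nlinarith
  have hsi : 4 ≤ s⁻¹ := by
    rw [le_inv_comm₀ (by norm_num) hs0]; linarith
  set M := ⌊s⁻¹⌋₊ with hM
  have hM1 : (M : ℝ) ≤ s⁻¹ := Nat.floor_le (by positivity)
  have hM2 : s⁻¹ < M + 1 := Nat.lt_floor_add_one _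
  have hM4 : 4 ≤ M := Nat.le_floor (by exact_mod_cast hsi)
  have hM3 : s⁻¹ / 2 ≤ M := by linarith
  have hMt : (M : ℝ) ^ 2 * t ≤ 1 := by
    have : (M : ℝ) ^ 2 ≤ (s⁻¹) ^ 2 := by gcongr
    calc (M : ℝ) ^ 2 * t ≤ (s⁻¹) ^ 2 * t := by gcongr
      _ = 1 := by rw [← hst]; field_simp
  have key : ∀ h : ℕ, 4 * h ≤ M → 2 / 655360 * min 1 ((u / t) ^ 2) ≤ 1 - Real.cos ((h : ℝ) ^ 2 * u) →
      (LF ((t : ℂ) + u * Complex.I)).re - (LF (t : ℂ)).re ≤ -(1 / 10 ^ 9 * s⁻¹ * min 1 ((u / t) ^ 2)) := by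
    intro h h4 hc
    refine (arc_h u ht h M h4 hMt).trans ?_
    have hm0 : 0 ≤ min 1 ((u / t) ^ 2) := le_min zero_le_one (sq_nonneg _)
    have : s⁻¹ / 2 / 540 * (2 / 655360 * min 1 ((u / t) ^ 2)) ≤ (M : ℝ) / 540 * (1 - Real.cos ((h : ℝ) ^ 2 * u)) := by
      gcongr
    have h8 : 0 ≤ s⁻¹ * min 1 ((u / t) ^ 2) := by positivity
    nlinarith
  have hq : ∀ x : ℝ, |x| ≤ Real.pi → x ^ 2 / 5 ≤ 1 - Real.cos x := by
    intro x hx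
    have := Real.cos_le_one_sub_mul_cos_sq hx
    have h2 : 2 / 10 * x ^ 2 ≤ 2 / Real.pi ^ 2 * x ^ 2 := by gcongr
    linarith
  set h0 := M / 4 with hh0
  have hh1 : 4 * h0 ≤ M := by omega
  have hh2 : (M : ℝ) / 8 ≤ h0 := by
    have : M ≤ 8 * h0 := by omega
    have : (M : ℝ) ≤ 8 * h0 := by exact_mod_cast this
    linarith
  have hh3 : 1 / (256 * t) ≤ (h0 : ℝ) ^ 2 := by
    have : s⁻¹ / 16 ≤ h0 := by linarith
    have : (s⁻¹ / 16) ^ 2 ≤ (h0 : ℝ) ^ 2 := by gcongr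
    refine le_trans (le_of_eq ?_) this
    rw [← hst]; field_simp; norm_num
  by_cases hc : (h0 : ℝ) ^ 2 * |u| ≤ Real.pi
  · apply key h0 hh1
    have h5 := hq ((h0 : ℝ) ^ 2 * u) (by rw [abs_mul, abs_of_nonneg (by positivity)]; exact hc)
    refine le_trans ?_ h5
    have h6 : ((1 / (256 * t)) * |u|) ^ 2 ≤ ((h0 : ℝ) ^ 2 * |u|) ^ 2 := by gcongr
    have h7 : ((h0 : ℝ) ^ 2 * |u|) ^ 2 = ((h0 : ℝ) ^ 2 * u) ^ 2 := by rw [mul_pow, sq_abs, ← mul_pow]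
    have h8 : ((1 / (256 * t)) * |u|) ^ 2 = (u / t) ^ 2 / 65536 := by
      rw [mul_pow, sq_abs]; field_simp; ring
    have h9 := min_le_right 1 ((u / t) ^ 2)
    have := sq_nonneg (u / t)
    linarith
  · push Not at hc
    have hu0 : 0 < |u| := by
      rcases (abs_nonneg u).lt_or_eq with h | h
      · exact h
      · rw [← h, mul_zero] at hc; linarith
    set y := Real.sqrt (Real.pi / |u|) with hy
    have hy2 : y ^ 2 = Real.pi / |u| := Real.sq_sqrt (by positivity)
    have hy1 : 1 ≤ y := by
      rw [hy, Real.one_le_sqrt, le_div_iff₀ hu0]; linarith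
    have hyh : y < h0 := by
      apply lt_of_pow_lt_pow_left₀ 2 (by positivity)
      rw [hy2, div_lt_iff₀ hu0]; exact hc
    have f1 : (⌊y⌋₊ : ℝ) ≤ y := Nat.floor_le (by positivity)
    have f2 : y < ⌊y⌋₊ + 1 := Nat.lt_floor_add_one _
    have f3 : 1 ≤ ⌊y⌋₊ := Nat.le_floor (by exact_mod_cast hy1)
    have f3r : (1:ℝ) ≤ ⌊y⌋₊ := by exact_mod_cast f3
    have f4 : ⌊y⌋₊ ≤ h0 := by
      have : (⌊y⌋₊ : ℝ) ≤ h0 := by linarith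
      exact_mod_cast this
    apply key ⌊y⌋₊ (by omega)
    have g1 : (⌊y⌋₊ : ℝ) ^ 2 * |u| ≤ Real.pi := by
      calc (⌊y⌋₊ : ℝ) ^ 2 * |u| ≤ y ^ 2 * |u| := by gcongr
        _ = Real.pi := by rw [hy2]; field_simp
    have g2 : Real.pi / 4 ≤ (⌊y⌋₊ : ℝ) ^ 2 * |u| := by
      have : y / 2 ≤ ⌊y⌋₊ := by linarith
      calc Real.pi / 4 = (y / 2) ^ 2 * |u| := by rw [div_pow, hy2]; field_simp; norm_num
        _ ≤ (⌊y⌋₊ : ℝ) ^ 2 * |u| := by gcongr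
    have h5 := hq ((⌊y⌋₊ : ℝ) ^ 2 * u) (by rw [abs_mul, abs_of_nonneg (by positivity)]; exact g1)
    refine le_trans ?_ h5
    have h7 : ((⌊y⌋₊ : ℝ) ^ 2 * |u|) ^ 2 = ((⌊y⌋₊ : ℝ) ^ 2 * u) ^ 2 := by rw [mul_pow, sq_abs, ← mul_pow]
    have h6 : (Real.pi / 4) ^ 2 ≤ ((⌊y⌋₊ : ℝ) ^ 2 * |u|) ^ 2 := by gcongr
    have h9 := min_le_left 1 ((u / t) ^ 2)
    have := Real.pi_gt_three
    nlinarith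

end TriPart

namespace TriPart

lemma prod_eq {z : ℂ} (hz : 0 < z.re) (M : ℕ) :
    ∏ m ∈ Finset.range M, (1 - Complex.exp (-z) ^ tri m)⁻¹ =
      Complex.exp (∑ m ∈ Finset.range M, fL ((tri m : ℂ) * z)) := by
  rw [Complex.exp_sum]
  apply Finset.prod_congr rfl
  intro m _
  have := re_smul_pos hz (tri_real_pos m)
  rw [Complex.ofReal_natCast] at this
  rw [exp_fL this, ← Complex.exp_nat_mul, mul_neg]

lemma prod_tendsto {z : ℂ} (hz : 0 < z.re) :
    Tendsto (fun M => ∏ m ∈ Finset.range M, (1 - Complex.exp (-z) ^ tri m)⁻¹) atTop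
      (𝓝 (Complex.exp (LF z))) := by
  simp_rw [prod_eq hz]
  exact (Complex.continuous_exp.tendsto _).comp (summable_fL hz).hasSum.tendsto_sum_nat

lemma genfun_exp {z : ℂ} (hz : 0 < z.re) :
    (Summable fun n => (pTri n : ℝ) * Real.exp (-z.re) ^ n) ∧
      HasSum (fun n => (pTri n : ℂ) * Complex.exp (-z) ^ n) (Complex.exp (LF z)) := by
  have hn : ‖Complex.exp (-z)‖ = Real.exp (-z.re) := by rw [Complex.norm_exp, Complex.neg_re]
  have hlt := norm_exp_neg_lt hz
  have h1 : Tendsto (fun M => ‖∏ m ∈ Finset.range M, (1 - Complex.exp (-(z.re : ℂ)) ^ tri m)⁻¹‖) atTop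
      (𝓝 ‖Complex.exp (LF (z.re : ℂ))‖) := (prod_tendsto (z := (z.re : ℂ)) (by simpa using hz)).norm
  obtain ⟨B, hB⟩ := h1.bddAbove_range
  have := genfun (Complex.exp (-z)) hlt B ?_ _ (prod_tendsto hz)
  · rw [hn] at this; exact this
  · intro M
    refine le_trans (le_of_eq ?_) (hB ⟨M, rfl⟩)
    simp only [norm_prod, norm_inv]
    apply Finset.prod_congr rfl
    intro m _
    have e : (1 : ℂ) - Complex.exp (-(z.re : ℂ)) ^ tri m = ((1 - ‖Complex.exp (-z)‖ ^ tri m : ℝ) : ℂ) := by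
      rw [hn]; push_cast; rfl
    have h2 : ‖Complex.exp (-z)‖ ^ tri m ≤ 1 := pow_le_one₀ (norm_nonneg _) hlt.le
    rw [e, Complex.norm_real, Real.norm_of_nonneg (by linarith)]

lemma int_exp (k n : ℕ) (h : k ≠ n) :
    ∫ u in (-Real.pi)..Real.pi, Complex.exp (((n : ℂ) - k) * Complex.I * (u : ℂ)) = 0 := by
  have hne : ((n : ℂ) - k) * Complex.I ≠ 0 := by
    apply mul_ne_zero _ Complex.I_ne_zero
    rw [sub_ne_zero]; exact_mod_cast h.symm
  rw [integral_exp_mul_complex hne]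
  have : Complex.exp (((n : ℂ) - k) * Complex.I * (Real.pi : ℂ)) =
      Complex.exp (((n : ℂ) - k) * Complex.I * ((-Real.pi : ℝ) : ℂ)) := by
    rw [Complex.exp_eq_exp_iff_exists_int]
    refine ⟨(n : ℤ) - k, ?_⟩
    push_cast
    ring
  rw [this, sub_self, zero_div]

theorem cauchy {t : ℝ} (ht : 0 < t) (n : ℕ) :
    ∫ u in (-Real.pi)..Real.pi, Complex.exp (LF ((t : ℂ) + u * Complex.I)) * Complex.exp (n * ((t : ℂ) + u * Complex.I))
      = 2 * Real.pi * (pTri n : ℂ) := by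
  have hre : ∀ u : ℝ, ((t : ℂ) + u * Complex.I).re = t := by intro u; simp
  have hg : ∀ u : ℝ, HasSum (fun k => (pTri k : ℂ) * Complex.exp (-((t : ℂ) + u * Complex.I)) ^ k *
      Complex.exp (n * ((t : ℂ) + u * Complex.I)))
      (Complex.exp (LF ((t : ℂ) + u * Complex.I)) * Complex.exp (n * ((t : ℂ) + u * Complex.I))) :=
    fun u => (genfun_exp (by rw [hre]; exact ht)).2.mul_right _
  have hs : Summable fun k => (pTri k : ℝ) * Real.exp (-t) ^ k * Real.exp (n * t) := by
    have := (genfun_exp (z := (t : ℂ)) (by simpa using ht)).1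
    rw [Complex.ofReal_re] at this
    exact this.mul_right _
  have h := intervalIntegral.hasSum_integral_of_dominated_convergence (μ := MeasureTheory.volume)
    (a := -Real.pi) (b := Real.pi)
    (F := fun k (u : ℝ) => (pTri k : ℂ) * Complex.exp (-((t : ℂ) + u * Complex.I)) ^ k *
      Complex.exp (n * ((t : ℂ) + u * Complex.I)))
    (f := fun u : ℝ => Complex.exp (LF ((t : ℂ) + u * Complex.I)) * Complex.exp (n * ((t : ℂ) + u * Complex.I)))
    (fun k _ => (pTri k : ℝ) * Real.exp (-t) ^ k * Real.exp (n * t))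
    (fun k => (Continuous.aestronglyMeasurable (by fun_prop)))
    (fun k => Eventually.of_forall fun u _ => by
      rw [norm_mul, norm_mul, norm_pow, Complex.norm_exp, Complex.norm_exp, Complex.neg_re, hre,
        Complex.norm_natCast]
      apply le_of_eq
      congr 2
      simp)
    (Eventually.of_forall fun u _ => hs) (by simp)
    (Eventually.of_forall fun u _ => hg u)
  have e : ∀ k : ℕ, (∫ u in (-Real.pi)..Real.pi, (pTri k : ℂ) * Complex.exp (-((t : ℂ) + u * Complex.I)) ^ k *
      Complex.exp (n * ((t : ℂ) + u * Complex.I))) =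
      (pTri k : ℂ) * Complex.exp (((n : ℂ) - k) * t) *
        ∫ u in (-Real.pi)..Real.pi, Complex.exp (((n : ℂ) - k) * Complex.I * (u : ℂ)) := by
    intro k
    rw [← intervalIntegral.integral_const_mul]
    congr 1
    funext u
    rw [← Complex.exp_nat_mul, mul_assoc, mul_assoc, ← Complex.exp_add, ← Complex.exp_add]
    congr 2
    ring
  have h0 := hasSum_single (f := fun k : ℕ => ∫ u in (-Real.pi)..Real.pi, (pTri k : ℂ) * Complex.exp (-((t : ℂ) + u * Complex.I)) ^ k *
      Complex.exp (n * ((t : ℂ) + u * Complex.I))) n (by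
        intro k hk
        simp only [e]
        rw [int_exp k n hk, mul_zero])
  rw [h.unique h0, e]
  simp
  ring

end TriPart

namespace TriPart

lemma ofReal_tendsto_zero : Tendsto (fun s : ℝ => s) (𝓝[>] (0:ℝ)) (𝓝 0) :=
  tendsto_id.mono_left nhdsWithin_le_nhds

lemma zs_tendsto (v : ℝ) :
    Tendsto (fun s : ℝ => ((s ^ 4 : ℝ) : ℂ) + (s ^ 5 * v : ℝ) * Complex.I) (𝓝[>] 0) lc := by
  unfold lc
  rw [tendsto_nhdsWithin_iff]
  constructor
  · have : Continuous (fun s : ℝ => ((s ^ 4 : ℝ) : ℂ) + (s ^ 5 * v : ℝ) * Complex.I) := by fun_prop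
    have h := this.tendsto 0
    simp only [ne_eq, OfNat.ofNat_ne_zero, not_false_eq_true, zero_pow, zero_mul, Complex.ofReal_zero, add_zero] at h
    exact h.mono_left nhdsWithin_le_nhds
  · have h1 : ∀ᶠ s : ℝ in 𝓝[>] 0, s * |v| < 1 := by
      have : Tendsto (fun s : ℝ => s * |v|) (𝓝[>] 0) (𝓝 (0 * |v|)) := ofReal_tendsto_zero.mul_const _
      rw [zero_mul] at this
      exact this.eventually_lt_const one_pos
    filter_upwards [h1, self_mem_nhdsWithin] with s hs hs0
    have hs0 : 0 < s := hs0
    have e1 : (((s ^ 4 : ℝ) : ℂ) + (s ^ 5 * v : ℝ) * Complex.I).re = s ^ 4 := by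
      rw [Complex.add_re, Complex.re_ofReal_mul, Complex.ofReal_re, Complex.I_re]; ring
    have e2 : (((s ^ 4 : ℝ) : ℂ) + (s ^ 5 * v : ℝ) * Complex.I).im = s ^ 5 * v := by
      rw [Complex.add_im, Complex.im_ofReal_mul, Complex.ofReal_im, Complex.I_im]; ring
    refine ⟨by rw [e1]; positivity, ?_⟩
    rw [e1, e2, abs_mul, abs_of_pos (by positivity : 0 < s ^ 5)]
    calc s ^ 5 * |v| = s ^ 4 * (s * |v|) := by ring
      _ ≤ s ^ 4 * 1 := by gcongr
      _ = s ^ 4 := mul_one _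

lemma local_alg {r w : ℂ} (h : r ^ 2 * (1 + w) = 1) (h1 : 1 + r ≠ 0) :
    r - 1 + w / 2 = w ^ 2 * (r ^ 2 * (1 + 2 * r) / (2 * (1 + r) ^ 2)) := by
  field_simp
  linear_combination (2 * (1 + r) - w * (1 + 2 * r)) * h

lemma local_lim (v : ℝ) :
    Tendsto (fun s : ℝ => LF (((s ^ 4 : ℝ) : ℂ) + (s ^ 5 * v : ℝ) * Complex.I) - LF ((s ^ 4 : ℝ) : ℂ)
      + (cc / (2 * s) * v : ℝ) * Complex.I) (𝓝[>] 0) (𝓝 ((-(3 * cc / 8) * v ^ 2 : ℝ) : ℂ)) := by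
  have hz := LF_tendsto.comp (zs_tendsto v)
  have h0 := LF_tendsto.comp (zs_tendsto 0)
  have hd := hz.sub h0
  rw [sub_self] at hd
  set w : ℝ → ℂ := fun s => (s * v : ℝ) * Complex.I with hw
  have hw0 : Tendsto w (𝓝[>] 0) (𝓝 0) := by
    have : Continuous w := by fun_prop
    have h := this.tendsto 0
    simp only [hw, zero_mul, Complex.ofReal_zero] at h
    exact h.mono_left nhdsWithin_le_nhds
  have h1w : Tendsto (fun s => 1 + w s) (𝓝[>] 0) (𝓝 1) := by
    simpa using hw0.const_add 1
  have hlog : Tendsto (fun s => Complex.log (1 + w s)) (𝓝[>] 0) (𝓝 0) := by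
    have := ((continuousAt_clog (x := 1) (by simp)).tendsto).comp h1w
    rw [Complex.log_one] at this
    exact this
  set r : ℝ → ℂ := fun s => ((1 + w s)⁻¹) ^ (1 / 2 : ℂ) with hr
  have hr1 : Tendsto r (𝓝[>] 0) (𝓝 1) := by
    have h2 : Tendsto (fun s => (1 + w s)⁻¹) (𝓝[>] 0) (𝓝 1) := by
      simpa using h1w.inv₀ one_ne_zero
    have h3 : ContinuousAt (fun x : ℂ => x ^ (1 / 2 : ℂ)) 1 := by
      apply continuousAt_cpow_const; simp
    have := h3.tendsto.comp h2
    rw [Complex.one_cpow] at this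
    exact this
  have hq : Tendsto (fun s => r s ^ 2 * (1 + 2 * r s) / (2 * (1 + r s) ^ 2)) (𝓝[>] 0) (𝓝 (3 / 8)) := by
    have h2 : ContinuousAt (fun x : ℂ => x ^ 2 * (1 + 2 * x) / (2 * (1 + x) ^ 2)) 1 := by
      apply ContinuousAt.div (by fun_prop) (by fun_prop)
      norm_num
    have := h2.tendsto.comp hr1
    norm_num at this
    exact this
  have hlim := (hd.add hlog).add (hq.const_mul (-(cc : ℂ) * (v : ℂ) ^ 2))
  have hne : ∀ᶠ s in 𝓝[>] (0:ℝ), 1 + r s ≠ 0 := by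
    have : Tendsto (fun s => 1 + r s) (𝓝[>] 0) (𝓝 (1 + 1)) := hr1.const_add 1
    exact this.eventually_ne (by norm_num)
  have e0 : (0 : ℂ) + 0 + -(cc : ℂ) * (v : ℂ) ^ 2 * (3 / 8) = ((-(3 * cc / 8) * v ^ 2 : ℝ) : ℂ) := by
    push_cast; ring
  rw [e0] at hlim
  refine hlim.congr' ?_
  filter_upwards [hne, self_mem_nhdsWithin] with s hs1 hs0
  have hs0 : 0 < s := hs0
  have hsc : (s : ℂ) ≠ 0 := by exact_mod_cast hs0.ne'
  have hw1 : 1 + w s ≠ 0 := by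
    intro h
    have := congrArg Complex.re h
    simp [hw] at this
  have ez : ((s ^ 4 : ℝ) : ℂ) + (s ^ 5 * v : ℝ) * Complex.I = ((s ^ 4 : ℝ) : ℂ) * (1 + w s) := by
    simp only [hw]; push_cast; ring
  have ez0 : ((s ^ 4 : ℝ) : ℂ) + (s ^ 5 * 0 : ℝ) * Complex.I = ((s ^ 4 : ℝ) : ℂ) := by
    simp
  have el : Complex.log (((s ^ 4 : ℝ) : ℂ) * (1 + w s)) = Complex.log ((s ^ 4 : ℝ) : ℂ) + Complex.log (1 + w s) := by
    rw [Complex.log_ofReal_mul (by positivity) hw1, Complex.ofReal_log (by positivity)]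
  have hsq : Real.sqrt ((s ^ 4)⁻¹) = (s ^ 2)⁻¹ := by
    rw [Real.sqrt_eq_iff_mul_self_eq (by positivity) (by positivity)]
    field_simp
  have hp : ∀ x : ℂ, x ≠ 0 → (((s ^ 4 : ℝ) : ℂ) * x)⁻¹ ^ (1 / 2 : ℂ) = ((s : ℂ) ^ 2)⁻¹ * (x⁻¹) ^ (1 / 2 : ℂ) := by
    intro x hx
    rw [mul_inv, ← Complex.ofReal_inv, real_mul_cpow_half (by positivity) (inv_ne_zero hx), hsq]
    push_cast; rfl
  have hp1 := hp _ hw1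
  have hp0 := hp 1 one_ne_zero
  rw [mul_one, inv_one, Complex.one_cpow, mul_one] at hp0
  have hr2 : r s ^ 2 * (1 + w s) = 1 := by
    have : r s ^ 2 = (1 + w s)⁻¹ := by
      simp only [hr]
      rw [← Complex.cpow_nat_mul]
      norm_num
    rw [this, inv_mul_cancel₀ hw1]
  have ha := local_alg hr2 hs1
  have hww : w s ^ 2 = -((s : ℂ) ^ 2 * (v : ℂ) ^ 2) := by
    simp only [hw]; rw [mul_pow, Complex.I_sq]; push_cast; ring
  have hq' : -(cc : ℂ) * (v : ℂ) ^ 2 * (r s ^ 2 * (1 + 2 * r s) / (2 * (1 + r s) ^ 2)) =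
      cc * ((s : ℂ) ^ 2)⁻¹ * (r s - 1 + w s / 2) := by
    rw [ha, hww]
    field_simp
  simp only [Function.comp]
  rw [hq', ez, ez0, el, hp1, hp0]
  change _ - (cc : ℂ) * (((s : ℂ) ^ 2)⁻¹ * r s) - _ - _ + _ + _ = _
  simp only [hw]
  push_cast
  field_simp
  ring

lemma dom_aux {s v : ℝ} (hs : 0 < s) (hs2 : s ≤ 1 / 2) (hv : |s ^ 5 * v| ≤ Real.pi) :
    Real.exp (-(1 / 10 ^ 9 * (s ^ 2)⁻¹ * min 1 ((s * v) ^ 2))) ≤ 1320 * 10 ^ 45 * (1 + v ^ 2)⁻¹ := by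
  have hv2 : 0 ≤ v ^ 2 := sq_nonneg v
  rw [Real.exp_neg, ← div_eq_mul_inv (1320 * 10 ^ 45), inv_eq_one_div (Real.exp _), div_le_div_iff₀ (Real.exp_pos _) (by positivity), one_mul]
  rcases le_total ((s * v) ^ 2) 1 with h | h
  · rw [min_eq_right h]
    have e : 1 / 10 ^ 9 * (s ^ 2)⁻¹ * (s * v) ^ 2 = v ^ 2 / 10 ^ 9 := by field_simp
    rw [e]
    have := Real.add_one_le_exp (v ^ 2 / 10 ^ 9)
    linarith
  · rw [min_eq_left h, mul_one]
    have h1 : (1 / 10 ^ 9 * (s ^ 2)⁻¹) ^ 5 / (Nat.factorial 5) ≤ Real.exp (1 / 10 ^ 9 * (s ^ 2)⁻¹) :=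
      Real.pow_div_factorial_le_exp _ (by positivity) 5
    have h2 : (1 / 10 ^ 9 * (s ^ 2)⁻¹) ^ 5 / (Nat.factorial 5) = (s ^ 10)⁻¹ / (120 * 10 ^ 45) := by
      norm_num [Nat.factorial]; field_simp; norm_num
    rw [h2] at h1
    have h3 : (s ^ 5 * v) ^ 2 ≤ Real.pi ^ 2 := by
      rw [← sq_abs]; gcongr
    have hpi2 : Real.pi ^ 2 < 10 := by nlinarith [Real.pi_lt_d2, Real.pi_pos]
    have h4 : v ^ 2 ≤ 10 * (s ^ 10)⁻¹ := by
      rw [← div_eq_mul_inv, le_div_iff₀ (by positivity)]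
      nlinarith
    have h5 : 1 ≤ (s ^ 10)⁻¹ := by
      rw [one_le_inv₀ (by positivity)]
      exact pow_le_one₀ hs.le (by linarith)
    have : (s ^ 10)⁻¹ * 11 ≤ 1320 * 10 ^ 45 * Real.exp (1 / 10 ^ 9 * (s ^ 2)⁻¹) := by
      calc (s ^ 10)⁻¹ * 11 = 1320 * 10 ^ 45 * ((s ^ 10)⁻¹ / (120 * 10 ^ 45)) := by ring
        _ ≤ _ := by gcongr
    linarith

noncomputable def GG (s v : ℝ) : ℂ :=
  Complex.exp (LF (((s ^ 4 : ℝ) : ℂ) + (s ^ 5 * v : ℝ) * Complex.I) - LF ((s ^ 4 : ℝ) : ℂ)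
      + (cc / (2 * s) * v : ℝ) * Complex.I)

lemma GG_bound {s v : ℝ} (hs : 0 < s) (hs2 : s ≤ 1 / 2) (hv : |s ^ 5 * v| ≤ Real.pi) :
    ‖GG s v‖ ≤ 1320 * 10 ^ 45 * (1 + v ^ 2)⁻¹ := by
  refine le_trans ?_ (dom_aux hs hs2 hv)
  unfold GG
  rw [Complex.norm_exp]
  apply Real.exp_le_exp.2
  have hs4 : s ^ 4 ≤ 1 / 16 := by
    calc s ^ 4 ≤ (1 / 2) ^ 4 := by gcongr
      _ = 1 / 16 := by norm_num
  have h := arc (t := s ^ 4) (u := s ^ 5 * v) (by positivity) hs4 hv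
  have e1 : Real.sqrt (s ^ 4) = s ^ 2 := by
    rw [Real.sqrt_eq_iff_mul_self_eq (by positivity) (by positivity)]; ring
  have e2 : s ^ 5 * v / s ^ 4 = s * v := by field_simp
  rw [e1, e2] at h
  refine le_trans (le_of_eq ?_) h
  rw [Complex.add_re, Complex.sub_re, Complex.re_ofReal_mul, Complex.I_re]
  ring

lemma measurable_expLF {s : ℝ} (hs : 0 < s) :
    Measurable fun v : ℝ => Complex.exp (LF (((s ^ 4 : ℝ) : ℂ) + (s ^ 5 * v : ℝ) * Complex.I)) := by
  apply measurable_of_tendsto_metrizable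
    (f := fun M (v : ℝ) => ∏ m ∈ Finset.range M, (1 - Complex.exp (-(((s ^ 4 : ℝ) : ℂ) + (s ^ 5 * v : ℝ) * Complex.I)) ^ tri m)⁻¹)
  · intro M
    apply Finset.measurable_prod
    intro m _
    apply Measurable.inv
    apply Continuous.measurable
    fun_prop
  · rw [tendsto_pi_nhds]
    intro v
    apply prod_tendsto
    rw [Complex.add_re, Complex.re_ofReal_mul, Complex.ofReal_re, Complex.I_re]
    have : 0 < s ^ 4 := by positivity
    linarith

lemma measurable_GG {s : ℝ} (hs : 0 < s) : Measurable (GG s) := by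
  have e : GG s = fun v : ℝ => Complex.exp (LF (((s ^ 4 : ℝ) : ℂ) + (s ^ 5 * v : ℝ) * Complex.I)) *
      Complex.exp (- LF ((s ^ 4 : ℝ) : ℂ) + (cc / (2 * s) * v : ℝ) * Complex.I) := by
    funext v
    unfold GG
    rw [← Complex.exp_add]
    congr 1
    ring
  rw [e]
  apply (measurable_expLF hs).mul
  apply Continuous.measurable
  fun_prop

noncomputable def II (s : ℝ) : ℂ := ∫ v in (-Real.pi / s ^ 5)..(Real.pi / s ^ 5), GG s v

lemma II_tendsto : Tendsto II (𝓝[>] 0) (𝓝 ((Real.sqrt (Real.pi / (3 * cc / 8)) : ℝ) : ℂ)) := by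
  have hpi := Real.pi_pos
  have e : ((Real.sqrt (Real.pi / (3 * cc / 8)) : ℝ) : ℂ) = ∫ v : ℝ, ((Real.exp (-(3 * cc / 8) * v ^ 2) : ℝ) : ℂ) := by
    rw [← integral_gaussian]; exact (integral_ofReal (𝕜 := ℂ)).symm
  rw [e]
  have e2 : ∀ᶠ s in 𝓝[>] (0:ℝ), ∫ v, (Set.Ioc (-Real.pi / s ^ 5) (Real.pi / s ^ 5)).indicator (GG s) v = II s := by
    filter_upwards [self_mem_nhdsWithin] with s hs
    have hs : 0 < s := hs
    unfold II
    rw [intervalIntegral.integral_of_le, MeasureTheory.integral_indicator measurableSet_Ioc]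
    gcongr
    linarith
  refine Tendsto.congr' e2 ?_
  have hhalf : ∀ᶠ s in 𝓝[>] (0:ℝ), s ≤ 1 / 2 :=
    (ofReal_tendsto_zero.eventually_le_const (by norm_num))
  apply MeasureTheory.tendsto_integral_filter_of_dominated_convergence (fun v => 1320 * 10 ^ 45 * (1 + v ^ 2)⁻¹)
  · filter_upwards [self_mem_nhdsWithin] with s hs
    exact ((measurable_GG hs).indicator measurableSet_Ioc).aestronglyMeasurable
  · filter_upwards [self_mem_nhdsWithin, hhalf] with s hs hs2
    have hs : 0 < s := hs
    refine Eventually.of_forall fun v => ?_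
    by_cases hv : v ∈ Set.Ioc (-Real.pi / s ^ 5) (Real.pi / s ^ 5)
    · rw [Set.indicator_of_mem hv]
      apply GG_bound hs hs2
      have h1 := hv.1
      have h2 := hv.2
      rw [div_lt_iff₀ (by positivity)] at h1
      rw [le_div_iff₀ (by positivity)] at h2
      rw [abs_le]
      constructor <;> linarith
    · rw [Set.indicator_of_notMem hv, norm_zero]; positivity
  · exact integrable_inv_one_add_sq.const_mul _
  · refine Eventually.of_forall fun v => ?_
    have h1 : Tendsto (fun s => GG s v) (𝓝[>] 0) (𝓝 ((Real.exp (-(3 * cc / 8) * v ^ 2) : ℝ) : ℂ)) := by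
      rw [Complex.ofReal_exp]
      exact (Complex.continuous_exp.tendsto _).comp (local_lim v)
    refine h1.congr' ?_
    have h2 : Tendsto (fun s : ℝ => s ^ 5 * |v|) (𝓝[>] 0) (𝓝 0) := by
      have : Continuous (fun s : ℝ => s ^ 5 * |v|) := by fun_prop
      have h := this.tendsto 0
      simp only [ne_eq, OfNat.ofNat_ne_zero, not_false_eq_true, zero_pow, zero_mul] at h
      exact h.mono_left nhdsWithin_le_nhds
    filter_upwards [self_mem_nhdsWithin, h2.eventually_lt_const hpi] with s hs hs2
    have hs : 0 < s := hs
    have h5 : 0 < s ^ 5 := by positivity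
    rw [Set.indicator_of_mem]
    rw [← abs_of_pos h5, ← abs_mul, abs_lt] at hs2
    constructor
    · rw [div_lt_iff₀ h5]; linarith
    · rw [le_div_iff₀ h5]; linarith

lemma main_eq {s : ℝ} (hs : 0 < s) (n : ℕ) (hn : (n : ℝ) * s ^ 6 = cc / 2) :
    2 * Real.pi * (pTri n : ℂ) =
      (s : ℂ) ^ 5 * (Complex.exp (LF ((s ^ 4 : ℝ) : ℂ)) * Complex.exp ((n * s ^ 4 : ℝ) : ℂ) * II s) := by
  have h5 : s ^ 5 ≠ 0 := by positivity
  rw [← cauchy (t := s ^ 4) (by positivity) n]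
  have h := intervalIntegral.integral_comp_mul_left (a := -Real.pi / s ^ 5) (b := Real.pi / s ^ 5)
    (fun u : ℝ => Complex.exp (LF (((s ^ 4 : ℝ) : ℂ) + u * Complex.I)) * Complex.exp (n * (((s ^ 4 : ℝ) : ℂ) + u * Complex.I))) h5
  rw [show s ^ 5 * (-Real.pi / s ^ 5) = -Real.pi by field_simp, show s ^ 5 * (Real.pi / s ^ 5) = Real.pi by field_simp] at h
  have h2 : ∀ v : ℝ, Complex.exp (LF (((s ^ 4 : ℝ) : ℂ) + (s ^ 5 * v : ℝ) * Complex.I)) *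
      Complex.exp (n * (((s ^ 4 : ℝ) : ℂ) + (s ^ 5 * v : ℝ) * Complex.I)) =
      Complex.exp (LF ((s ^ 4 : ℝ) : ℂ)) * Complex.exp ((n * s ^ 4 : ℝ) : ℂ) * GG s v := by
    intro v
    unfold GG
    rw [← Complex.exp_add, ← Complex.exp_add, ← Complex.exp_add]
    congr 1
    have : (cc / (2 * s) * v : ℝ) = n * (s ^ 5 * v) := by
      rw [show cc / (2 * s) = cc / 2 / s by field_simp, ← hn]; field_simp
    rw [this]
    push_cast
    ring
  simp only [h2] at h
  rw [intervalIntegral.integral_const_mul] at h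
  unfold II
  have hsc : (s : ℂ) ^ 5 * (((s ^ 5)⁻¹ : ℝ) : ℂ) = 1 := by
    rw [← Complex.ofReal_pow, ← Complex.ofReal_mul, mul_inv_cancel₀ h5, Complex.ofReal_one]
  rw [h, Complex.real_smul, ← mul_assoc, hsc, one_mul]

lemma expLF_tendsto : Tendsto (fun s : ℝ => Complex.exp (LF ((s ^ 4 : ℝ) : ℂ)) /
    ((s ^ 4 * Real.exp (cc * (s ^ 2)⁻¹) : ℝ) : ℂ)) (𝓝[>] 0) (𝓝 (((4 * Real.pi)⁻¹ : ℝ) : ℂ)) := by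
  have h0 := (Complex.continuous_exp.tendsto _).comp (LF_tendsto.comp (zs_tendsto 0))
  have hpi := Real.pi_pos
  rw [← Complex.ofReal_exp, Real.exp_neg, Real.exp_log (by positivity)] at h0
  refine h0.congr' ?_
  filter_upwards [self_mem_nhdsWithin] with s hs
  have hs : 0 < s := hs
  have hsc : (s : ℂ) ≠ 0 := by exact_mod_cast hs.ne'
  have hsq : Real.sqrt ((s ^ 4)⁻¹) = (s ^ 2)⁻¹ := by
    rw [Real.sqrt_eq_iff_mul_self_eq (by positivity) (by positivity)]
    field_simp
  have hp := real_mul_cpow_half (r := (s ^ 4)⁻¹) (by positivity) (w := 1) one_ne_zero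
  rw [hsq, mul_one, Complex.one_cpow, mul_one, Complex.ofReal_inv] at hp
  have ez0 : ((s ^ 4 : ℝ) : ℂ) + (s ^ 5 * 0 : ℝ) * Complex.I = ((s ^ 4 : ℝ) : ℂ) := by
    simp
  simp only [Function.comp]
  rw [ez0, hp, Complex.exp_sub, Complex.exp_sub, Complex.exp_log (by exact_mod_cast (pow_pos hs 4).ne')]
  rw [div_div]
  push_cast
  congr 1
  ring

end TriPart

namespace TriPart

noncomputable def sn (n : ℕ) : ℝ := (cc / (2 * n)) ^ (1 / 6 : ℝ)

lemma sn_pos {n : ℕ} (hn : 0 < n) : 0 < sn n := by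
  have := cc_pos
  have : (0:ℝ) < n := by exact_mod_cast hn
  unfold sn
  positivity

lemma sn_pow {n : ℕ} (hn : 0 < n) : sn n ^ 6 = cc / (2 * n) := by
  have := cc_pos
  have : (0:ℝ) < n := by exact_mod_cast hn
  unfold sn
  rw [← Real.rpow_natCast, ← Real.rpow_mul (by positivity)]
  norm_num

lemma sn_tendsto : Tendsto sn atTop (𝓝[>] 0) := by
  rw [tendsto_nhdsWithin_iff]
  constructor
  · have h1 : Tendsto (fun n : ℕ => cc / (2 * (n : ℝ))) atTop (𝓝 0) :=
      (tendsto_natCast_atTop_atTop.const_mul_atTop (by norm_num : (0:ℝ) < 2)).const_div_atTop cc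
    have h2 := h1.rpow_const (p := (1 / 6 : ℝ)) (Or.inr (by norm_num))
    rw [Real.zero_rpow (by norm_num)] at h2
    exact h2
  · filter_upwards [eventually_gt_atTop 0] with n hn
    exact sn_pos hn

lemma cc_sq : cc ^ 2 = Real.pi / 2 * zetaThreeHalves ^ 2 := by
  unfold cc
  rw [mul_pow, div_pow, Real.sq_sqrt (by have := Real.pi_pos; positivity)]
  ring

lemma exponent_eq {n : ℕ} (hn : 0 < n) :
    cc * (sn n ^ 2)⁻¹ + n * sn n ^ 4 = (3 / 2) * Real.pi ^ ((1 : ℝ) / 3) * zetaThreeHalves ^ ((2 : ℝ) / 3) *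
            (n : ℝ) ^ ((1 : ℝ) / 3) := by
  have hs := sn_pos hn
  have h6 := sn_pow hn
  have hz := zeta_pos
  have hpi := Real.pi_pos
  have hn' : (0:ℝ) < n := by exact_mod_cast hn
  have hcc : cc = 2 * n * sn n ^ 6 := by rw [h6]; field_simp
  have e1 : cc * (sn n ^ 2)⁻¹ = 2 * (n * sn n ^ 4) := by
    rw [hcc]; field_simp
  have e2 : n * sn n ^ 4 = (1 / 2) * (Real.pi ^ ((1 : ℝ) / 3) * zetaThreeHalves ^ ((2 : ℝ) / 3) *
            (n : ℝ) ^ ((1 : ℝ) / 3)) := by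
    apply (pow_left_inj₀ (by positivity) (by positivity) (by norm_num : (3:ℕ) ≠ 0)).1
    have a1 : (Real.pi ^ ((1 : ℝ) / 3)) ^ 3 = Real.pi := by
      rw [← Real.rpow_natCast, ← Real.rpow_mul hpi.le]; norm_num
    have a2 : ((n : ℝ) ^ ((1 : ℝ) / 3)) ^ 3 = n := by
      rw [← Real.rpow_natCast, ← Real.rpow_mul hn'.le]; norm_num
    have a3 : (zetaThreeHalves ^ ((2 : ℝ) / 3)) ^ 3 = zetaThreeHalves ^ 2 := by
      rw [← Real.rpow_natCast, ← Real.rpow_mul hz.le, ← Real.rpow_natCast]; norm_num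
    rw [mul_pow (1 / 2 : ℝ), mul_pow (_ * _) ((n : ℝ) ^ ((1 : ℝ) / 3)), mul_pow (Real.pi ^ ((1 : ℝ) / 3)), a1, a2, a3]
    calc (n * sn n ^ 4) ^ 3 = n ^ 3 * (sn n ^ 6) ^ 2 := by ring
      _ = n * cc ^ 2 / 4 := by rw [h6]; field_simp; norm_num
      _ = _ := by rw [cc_sq]; ring
  rw [e1, e2]
  ring

noncomputable def kk : ℝ := (8 * Real.pi ^ 2)⁻¹ * Real.sqrt (Real.pi / (3 * cc / 8))

lemma kk_pos : 0 < kk := by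
  have := cc_pos
  have := Real.pi_pos
  unfold kk
  positivity

lemma const_eq {n : ℕ} (hn : 0 < n) :
    zetaThreeHalves / (2 ^ ((7 : ℝ) / 2) * Real.sqrt 3 * Real.pi * (n : ℝ) ^ ((3 : ℝ) / 2)) = sn n ^ 9 * kk := by
  have hs := sn_pos hn
  have h6 := sn_pow hn
  have hz := zeta_pos
  have hpi := Real.pi_pos
  have hc := cc_pos
  have hk := kk_pos
  have hn' : (0:ℝ) < n := by exact_mod_cast hn
  apply (pow_left_inj₀ (by positivity) (by positivity) (by norm_num : (2:ℕ) ≠ 0)).1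
  have a1 : ((2:ℝ) ^ ((7 : ℝ) / 2)) ^ 2 = 128 := by
    rw [← Real.rpow_natCast, ← Real.rpow_mul (by norm_num)]; norm_num
  have a2 : ((n : ℝ) ^ ((3 : ℝ) / 2)) ^ 2 = (n : ℝ) ^ 3 := by
    rw [← Real.rpow_natCast, ← Real.rpow_mul hn'.le, ← Real.rpow_natCast]; norm_num
  have a3 : kk ^ 2 = (64 * Real.pi ^ 4)⁻¹ * (Real.pi / (3 * cc / 8)) := by
    unfold kk
    rw [mul_pow, Real.sq_sqrt (by positivity), inv_pow, mul_pow]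
    norm_num [← pow_mul]
  rw [div_pow, mul_pow, mul_pow, mul_pow, a1, a2, Real.sq_sqrt (by norm_num), mul_pow (sn n ^ 9), a3]
  have a4 : (sn n ^ 9) ^ 2 = (cc / (2 * n)) ^ 3 := by rw [← h6]; ring
  rw [a4]
  calc _ = (2 / Real.pi * (Real.pi / 2 * zetaThreeHalves ^ 2)) / (128 * 3 * Real.pi ^ 2 * n ^ 3) := by
        congr 1; field_simp
    _ = (2 / Real.pi * cc ^ 2) / (128 * 3 * Real.pi ^ 2 * n ^ 3) := by rw [cc_sq]
    _ = _ := by field_simp; norm_num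

theorem final : 
    Tendsto (fun n : ℕ => (pTri n : ℝ) /
        (zetaThreeHalves / (2 ^ ((7 : ℝ) / 2) * Real.sqrt 3 * Real.pi * (n : ℝ) ^ ((3 : ℝ) / 2)) *
          Real.exp ((3 / 2) * Real.pi ^ ((1 : ℝ) / 3) * zetaThreeHalves ^ ((2 : ℝ) / 3) *
            (n : ℝ) ^ ((1 : ℝ) / 3))))
      atTop (𝓝 1) := by
  have hpi := Real.pi_pos
  have hk := kk_pos
  have h := ((expLF_tendsto.comp sn_tendsto).mul (II_tendsto.comp sn_tendsto)).const_mul (((2 * Real.pi * kk)⁻¹ : ℝ) : ℂ)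
  rw [← Complex.ofReal_mul, ← Complex.ofReal_mul] at h
  have e : (2 * Real.pi * kk)⁻¹ * ((4 * Real.pi)⁻¹ * Real.sqrt (Real.pi / (3 * cc / 8))) = 1 := by
    have : (4 * Real.pi)⁻¹ * Real.sqrt (Real.pi / (3 * cc / 8)) = 2 * Real.pi * kk := by
      unfold kk; field_simp; ring
    rw [this, inv_mul_cancel₀ (by positivity)]
  rw [e] at h
  have h2 := (Complex.continuous_re.tendsto _).comp h
  rw [Complex.ofReal_re] at h2
  refine h2.congr' ?_
  filter_upwards [eventually_gt_atTop 0] with n hn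
  have hs := sn_pos hn
  have hn' : (0:ℝ) < n := by exact_mod_cast hn
  rw [const_eq hn, ← exponent_eq hn]
  have hm := main_eq hs n (by rw [sn_pow hn]; field_simp)
  simp only [Function.comp]
  rw [← Complex.ofReal_re ((pTri n : ℝ) / _)]
  congr 1
  have hsc : (sn n : ℂ) ≠ 0 := by exact_mod_cast hs.ne'
  have hkc : (kk : ℂ) ≠ 0 := by exact_mod_cast hk.ne'
  have hpc : (Real.pi : ℂ) ≠ 0 := by exact_mod_cast hpi.ne'
  have hp : (pTri n : ℂ) = (2 * Real.pi : ℂ)⁻¹ * ((sn n : ℂ) ^ 5 * (Complex.exp (LF ((sn n ^ 4 : ℝ) : ℂ)) * Complex.exp ((n * sn n ^ 4 : ℝ) : ℂ) * II (sn n))) := by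
    rw [← hm]; field_simp
  rw [Complex.ofReal_div, Complex.ofReal_natCast, hp, Real.exp_add]
  rw [← Complex.ofReal_exp]
  have hE1 : (Real.exp (n * sn n ^ 4) : ℂ) ≠ 0 := by exact_mod_cast (Real.exp_pos _).ne'
  have hE2 : (Real.exp (cc * (sn n ^ 2)⁻¹) : ℂ) ≠ 0 := by exact_mod_cast (Real.exp_pos _).ne'
  generalize Complex.exp (LF ((sn n ^ 4 : ℝ) : ℂ)) = L
  generalize Real.exp (n * sn n ^ 4) = E1 at hE1 ⊢
  generalize Real.exp (cc * (sn n ^ 2)⁻¹) = E2 at hE2 ⊢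
  push_cast
  field_simp

end TriPart


theorem stmt16 :
    Tendsto (fun n : ℕ => (pTri n : ℝ) /
        (zetaThreeHalves / (2 ^ ((7 : ℝ) / 2) * Real.sqrt 3 * Real.pi * (n : ℝ) ^ ((3 : ℝ) / 2)) *
          Real.exp ((3 / 2) * Real.pi ^ ((1 : ℝ) / 3) * zetaThreeHalves ^ ((2 : ℝ) / 3) *
            (n : ℝ) ^ ((1 : ℝ) / 3))))
      atTop (𝓝 1) := by
  exact TriPart.final
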